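/- Suppose W, Z ⊆ ℕ satisfy W ≰_T Z, and f : [ℕ]^3 → ℕ is a 2-bounded coloring that is computable relative to an oracle for Z. Then there exists an infinite f-rainbow X such that W ≰_T Z ⊕ X. -/

import Mathlib

namespace RRT

/-- Partial functions on ℕ that are recursive in the oracle `O`.
This mirrors `Nat.Partrec`, with an extra constructor for the oracle. -/
inductive RecursiveIn (O : ℕ →. ℕ) : (ℕ →. ℕ) → Prop
  | zero : RecursiveIn O (pure 0)
  | succ : RecursiveIn O Nat.succ
  | left : RecursiveIn O ↑fun n : ℕ => n.unpair.1
  | right : RecursiveIn O ↑fun n : ℕ => n.unpair.2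
  | oracle : RecursiveIn O O
  | pair {f g} : RecursiveIn O f → RecursiveIn O g →
      RecursiveIn O fun n => Nat.pair <$> f n <*> g n
  | comp {f g} : RecursiveIn O f → RecursiveIn O g →
      RecursiveIn O fun n => g n >>= f
  | prec {f g} : RecursiveIn O f → RecursiveIn O g →
      RecursiveIn O (Nat.unpaired fun a n =>
        n.rec (f a) fun y IH => do let i ← IH; g (Nat.pair a (Nat.pair y i)))
  | rfind {f} : RecursiveIn O f →
      RecursiveIn O fun a => Nat.rfind fun n => (fun m => m = 0) <$> f (Nat.pair a n)

/-- The characteristic function of a set of naturals. -/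
noncomputable def chi (A : Set ℕ) : ℕ → ℕ := A.indicator fun _ => 1

/-- Turing reducibility `A ≤_T B` for sets of naturals: the characteristic function of `A`
is computable relative to an oracle for the characteristic function of `B`. -/
def TuringLE (A B : Set ℕ) : Prop := RecursiveIn (chi B) (chi A)

/-- The recursive join `A ⊕ B = {2n : n ∈ A} ∪ {2n+1 : n ∈ B}`. -/
def join (A B : Set ℕ) : Set ℕ :=
  {n : ℕ | (∃ m ∈ A, n = 2 * m) ∨ (∃ m ∈ B, n = 2 * m + 1)}

/-- A total function `f : ℕ → ℕ` is computable relative to an oracle for `Z ⊆ ℕ`. -/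
def FunRecIn (Z : Set ℕ) (f : ℕ → ℕ) : Prop := RecursiveIn (chi Z) f


/-- A coloring of `[ℕ]³` (identified with strictly increasing triples) is 2-bounded if
every color has at most 2 preimages. -/
def Bounded2Triples (f : ℕ → ℕ → ℕ → ℕ) : Prop :=
  ∀ c : ℕ, {t : ℕ × ℕ × ℕ | t.1 < t.2.1 ∧ t.2.1 < t.2.2 ∧ f t.1 t.2.1 t.2.2 = c}.encard ≤ 2

/-- `X` is an `f`-rainbow for a coloring of triples: `f` is injective on `[X]³`. -/
def Rainbow3On (f : ℕ → ℕ → ℕ → ℕ) (X : Set ℕ) : Prop :=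
  ∀ x₀ x₁ x₂ y₀ y₁ y₂ : ℕ, x₀ ∈ X → x₁ ∈ X → x₂ ∈ X → y₀ ∈ X → y₁ ∈ X → y₂ ∈ X →
    x₀ < x₁ → x₁ < x₂ → y₀ < y₁ → y₁ < y₂ →
    f x₀ x₁ x₂ = f y₀ y₁ y₂ → x₀ = y₀ ∧ x₁ = y₁ ∧ x₂ = y₂

set_option linter.unusedSectionVars false
attribute [fun_prop] Primrec
attribute [fun_prop] Primrec.id Primrec.const Primrec.comp Primrec.fst Primrec.snd Primrec.pair
attribute [fun_prop] PrimrecPred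

/-! ### Primitive recursion automation -/

section Prim

variable {α β γ : Type*} [Primcodable α] [Primcodable β] [Primcodable γ]

@[fun_prop] theorem pr_id : Primrec (fun x : α => x) := Primrec.id

@[fun_prop] theorem pr_natPair {f g : α → ℕ} (hf : Primrec f) (hg : Primrec g) :
    Primrec (fun a => Nat.pair (f a) (g a)) := Primrec₂.natPair.comp hf hg

@[fun_prop] theorem pr_unpair {f : α → ℕ} (hf : Primrec f) :
    Primrec (fun a => Nat.unpair (f a)) := Primrec.unpair.comp hf

@[fun_prop] theorem pr_add {f g : α → ℕ} (hf : Primrec f) (hg : Primrec g) :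
    Primrec (fun a => (f a) + (g a)) := Primrec.nat_add.comp hf hg

@[fun_prop] theorem pr_sub {f g : α → ℕ} (hf : Primrec f) (hg : Primrec g) :
    Primrec (fun a => (f a) - (g a)) := Primrec.nat_sub.comp hf hg

@[fun_prop] theorem pr_mul {f g : α → ℕ} (hf : Primrec f) (hg : Primrec g) :
    Primrec (fun a => (f a) * (g a)) := Primrec.nat_mul.comp hf hg

@[fun_prop] theorem pr_div {f g : α → ℕ} (hf : Primrec f) (hg : Primrec g) :
    Primrec (fun a => (f a) / (g a)) := Primrec.nat_div.comp hf hg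

@[fun_prop] theorem pr_mod {f g : α → ℕ} (hf : Primrec f) (hg : Primrec g) :
    Primrec (fun a => (f a) % (g a)) := Primrec.nat_mod.comp hf hg

@[fun_prop] theorem pr_pow {f g : α → ℕ} (hf : Primrec f) (hg : Primrec g) :
    Primrec (fun a => (f a) ^ (g a)) :=
  (Primrec₂.unpaired'.1 Nat.Primrec.pow).comp hf hg

@[fun_prop] theorem pr_append {f g : α → List β} (hf : Primrec f) (hg : Primrec g) :
    Primrec (fun a => (f a) ++ (g a)) := Primrec.list_append.comp hf hg

@[fun_prop] theorem pr_cons {f : α → β} {g : α → List β} (hf : Primrec f) (hg : Primrec g) :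
    Primrec (fun a => (f a) :: (g a)) := Primrec.list_cons.comp hf hg

@[fun_prop] theorem pr_get {f : α → List β} {g : α → ℕ} (hf : Primrec f) (hg : Primrec g) :
    Primrec (fun a => (f a)[g a]?) := Primrec.list_getElem?.comp hf hg

@[fun_prop] theorem pr_take {f : α → List β} {g : α → ℕ} (hf : Primrec f) (hg : Primrec g) :
    Primrec (fun a => (f a).take (g a)) := Primrec.list_take.comp hg hf

@[fun_prop] theorem pr_some {f : α → β} (hf : Primrec f) : Primrec (fun a => some (f a)) :=
  Primrec.option_some.comp hf

@[fun_prop] theorem pr_len {f : α → List β} (hf : Primrec f) :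
    Primrec (fun a => (f a).length) := Primrec.list_length.comp hf

@[fun_prop] theorem pp_lt {f g : α → ℕ} (hf : Primrec f) (hg : Primrec g) :
    PrimrecPred (fun a => f a < g a) := Primrec.nat_lt.comp hf hg

@[fun_prop] theorem pp_le {f g : α → ℕ} (hf : Primrec f) (hg : Primrec g) :
    PrimrecPred (fun a => f a ≤ g a) := Primrec.nat_le.comp hf hg

@[fun_prop] theorem pp_eq {f g : α → β} (hf : Primrec f) (hg : Primrec g) :
    PrimrecPred (fun a => f a = g a) := Primrec.eq.comp hf hg

@[fun_prop] theorem pp_and {p q : α → Prop} (hp : PrimrecPred p) (hq : PrimrecPred q) :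
    PrimrecPred (fun a => p a ∧ q a) := hp.and hq

@[fun_prop] theorem pp_or {p q : α → Prop} (hp : PrimrecPred p) (hq : PrimrecPred q) :
    PrimrecPred (fun a => p a ∨ q a) := hp.or hq

@[fun_prop] theorem pp_not {p : α → Prop} (hp : PrimrecPred p) :
    PrimrecPred (fun a => ¬ p a) := hp.not

@[fun_prop] theorem pp_imp {p q : α → Prop} (hp : PrimrecPred p) (hq : PrimrecPred q) :
    PrimrecPred (fun a => p a → q a) :=
  (hp.not.or hq).of_eq fun a => by tauto

theorem pp_mem {f : α → β} {g : α → List β} (hf : Primrec f) (hg : Primrec g) :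
    PrimrecPred (fun a => f a ∈ g a) := by
  have h : PrimrecRel (fun (L : List β) (b : β) => ∃ x ∈ L, x = b) :=
    PrimrecRel.exists_mem_list Primrec.eq
  exact (h.comp hg hf).of_eq fun a => by simp

end Prim

/-! ### Sigma classes -/

/-- A countable family of sets of naturals with the closure properties of the sets that are
recursively enumerable in a fixed oracle. -/
structure SigClass (S : Set (Set ℕ)) : Prop where
  cnt : S.Countable
  prim : ∀ p : ℕ → Prop, PrimrecPred p → {n | p n} ∈ S
  inter : ∀ A ∈ S, ∀ B ∈ S, A ∩ B ∈ S
  union : ∀ A ∈ S, ∀ B ∈ S, A ∪ B ∈ S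
  proj : ∀ A ∈ S, {n | ∃ m, Nat.pair n m ∈ A} ∈ S
  comap : ∀ h : ℕ → ℕ, Primrec h → ∀ A ∈ S, h ⁻¹' A ∈ S
  ball : ∀ A ∈ S, {n | ∀ m < n.unpair.2, Nat.pair n.unpair.1 m ∈ A} ∈ S

/-- A predicate on a `Primcodable` type is in the class `S`. -/
def Sg (S : Set (Set ℕ)) {α : Type*} [Primcodable α] (P : α → Prop) : Prop :=
  {n : ℕ | ∃ a : α, Encodable.decode n = some a ∧ P a} ∈ S

section SgLemmas

open Encodable

variable {S S' : Set (Set ℕ)} {α β γ : Type*} [Primcodable α] [Primcodable β] [Primcodable γ]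

theorem Sg.mono (h : S ⊆ S') {P : α → Prop} (hP : Sg S P) : Sg S' P := h hP

theorem sg_nat {P : ℕ → Prop} : Sg S P ↔ {n | P n} ∈ S := by
  unfold Sg; simp

theorem SigClass.isSome (hS : SigClass S) :
    {n : ℕ | ∃ a : α, (decode n : Option α) = some a} ∈ S := by
  apply hS.prim
  have h : PrimrecPred (fun n : ℕ => (decode n : Option α).isSome = true) :=
    Primrec.eq.comp (Primrec.option_isSome.comp Primrec.decode) (Primrec.const true)
  exact h.of_eq fun n => by rw [Option.isSome_iff_exists]

theorem Sg.comp (hS : SigClass S) {P : β → Prop} (hP : Sg S P) {f : α → β} (hf : Primrec f) :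
    Sg S (fun a => P (f a)) := by
  have hk : Primrec (fun n : ℕ => ((decode n : Option α).map (fun a => encode (f a))).getD 0) :=
    Primrec.option_getD.comp (Primrec.option_map Primrec.decode
      ((Primrec.encode.comp (hf.comp Primrec.snd)).to₂)) (Primrec.const 0)
  have := hS.inter _ (hS.isSome (α := α)) _ (hS.comap _ hk _ hP)
  unfold Sg
  convert this using 1
  ext n
  constructor
  · rintro ⟨a, ha, hPa⟩
    refine ⟨⟨a, ha⟩, f a, ?_, hPa⟩
    simp [ha]
  · rintro ⟨⟨a, ha⟩, b, hb, hPb⟩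
    refine ⟨a, ha, ?_⟩
    simp [ha] at hb
    subst hb
    exact hPb

theorem Sg.of_eq {P Q : α → Prop} (hP : Sg S P) (h : ∀ a, P a ↔ Q a) : Sg S Q := by
  have : P = Q := funext fun a => propext (h a)
  rwa [← this]

theorem Sg.prim (hS : SigClass S) {P : α → Prop} (hP : PrimrecPred P) : Sg S P := by
  obtain ⟨hd, hP⟩ := hP
  have hk : Primrec (fun n : ℕ => ((decode n : Option α).map (fun a => decide (P a))).getD false) :=
    Primrec.option_getD.comp (Primrec.option_map Primrec.decode
      ((hP.comp Primrec.snd)).to₂) (Primrec.const false)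
  have h2 : PrimrecPred (fun n : ℕ =>
      ((decode n : Option α).map (fun a => decide (P a))).getD false = true) :=
    Primrec.eq.comp hk (Primrec.const true)
  unfold Sg
  convert hS.prim _ h2 using 1
  ext n
  constructor
  · rintro ⟨a, ha, hPa⟩
    simp [ha, hPa]
  · intro h
    cases hd : (decode n : Option α) with
    | none => simp [hd] at h
    | some a => exact ⟨a, hd, by simpa [hd] using h⟩

theorem Sg.and (hS : SigClass S) {P Q : α → Prop} (hP : Sg S P) (hQ : Sg S Q) :
    Sg S (fun a => P a ∧ Q a) := by
  unfold Sg
  convert hS.inter _ hP _ hQ using 1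
  ext n
  constructor
  · rintro ⟨a, ha, h1, h2⟩; exact ⟨⟨a, ha, h1⟩, ⟨a, ha, h2⟩⟩
  · rintro ⟨⟨a, ha, h1⟩, ⟨b, hb, h2⟩⟩
    rw [ha] at hb; cases hb
    exact ⟨a, ha, h1, h2⟩

theorem Sg.or (hS : SigClass S) {P Q : α → Prop} (hP : Sg S P) (hQ : Sg S Q) :
    Sg S (fun a => P a ∨ Q a) := by
  unfold Sg
  convert hS.union _ hP _ hQ using 1
  ext n
  constructor
  · rintro ⟨a, ha, h1 | h2⟩
    · exact Or.inl ⟨a, ha, h1⟩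
    · exact Or.inr ⟨a, ha, h2⟩
  · rintro (⟨a, ha, h1⟩ | ⟨b, hb, h2⟩)
    · exact ⟨a, ha, Or.inl h1⟩
    · exact ⟨b, hb, Or.inr h2⟩

theorem Sg.ex (hS : SigClass S) {P : α → β → Prop} (hP : Sg S (fun q : α × β => P q.1 q.2)) :
    Sg S (fun a => ∃ b, P a b) := by
  unfold Sg
  convert hS.proj _ hP using 1
  ext n
  constructor
  · rintro ⟨a, ha, b, h⟩
    exact ⟨encode b, (a, b), by simp [Encodable.decode_prod_val, ha], h⟩
  · rintro ⟨m, ⟨a, b⟩, hd, h⟩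
    simp only [Encodable.decode_prod_val, Nat.unpair_pair] at hd
    cases ha : (decode n : Option α) with
    | none => simp [ha] at hd
    | some a' =>
      cases hb : (decode m : Option β) with
      | none => simp [ha, hb] at hd
      | some b' =>
        simp [ha, hb] at hd
        obtain ⟨rfl, rfl⟩ := hd
        exact ⟨a', ha, b', h⟩

theorem Sg.ball (hS : SigClass S) {P : α → ℕ → Prop} (hP : Sg S (fun q : α × ℕ => P q.1 q.2))
    {f : α → ℕ} (hf : Primrec f) :
    Sg S (fun a => ∀ m < f a, P a m) := by
  have hk : Primrec (fun n : ℕ => Nat.pair n (((decode n : Option α).map (fun a => f a)).getD 0)) :=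
    Primrec₂.natPair.comp Primrec.id (Primrec.option_getD.comp (Primrec.option_map Primrec.decode
      ((hf.comp Primrec.snd)).to₂) (Primrec.const 0))
  have := hS.inter _ (hS.isSome (α := α)) _ (hS.comap _ hk _ (hS.ball _ hP))
  unfold Sg
  convert this using 1
  ext n
  constructor
  · rintro ⟨a, ha, h⟩
    refine ⟨⟨a, ha⟩, ?_⟩
    intro m hm
    simp [ha] at hm
    refine ⟨(a, m), by simp [Encodable.decode_prod_val, ha], h m hm⟩
  · rintro ⟨⟨a, ha⟩, h⟩
    refine ⟨a, ha, fun m hm => ?_⟩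
    obtain ⟨⟨b, m'⟩, hd, h'⟩ := h m (by simpa [ha] using hm)
    simp [Encodable.decode_prod_val, ha] at hd
    obtain ⟨rfl, rfl⟩ := hd
    exact h'

theorem Sg.ballList (hS : SigClass S) {P : α → β → Prop}
    (hP : Sg S (fun q : α × β => P q.1 q.2)) {f : α → List β} (hf : Primrec f) :
    Sg S (fun a => ∀ b ∈ f a, P a b) := by
  have : Sg S (fun a => ∀ i < (f a).length, ∃ b, (f a)[i]? = some b ∧ P a b) := by
    apply Sg.ball hS _ (by fun_prop)
    apply Sg.ex hS
    apply Sg.and hS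
    · apply Sg.prim hS; fun_prop
    · exact hP.comp hS (f := fun q : (α × ℕ) × β => (q.1.1, q.2)) (by fun_prop)
  refine this.of_eq fun a => ?_
  constructor
  · intro h b hb
    obtain ⟨i, hi, rfl⟩ := List.getElem_of_mem hb
    obtain ⟨b, h1, h2⟩ := h i hi
    rw [List.getElem?_eq_getElem hi] at h1
    cases h1
    exact h2
  · intro h i hi
    exact ⟨(f a)[i], List.getElem?_eq_getElem hi, h _ (List.getElem_mem hi)⟩

theorem Sg.imp (hS : SigClass S) {p P : α → Prop} (hp : PrimrecPred p) (hP : Sg S P) :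
    Sg S (fun a => p a → P a) :=
  (Sg.or hS (Sg.prim hS hp.not) hP).of_eq fun a => by tauto

theorem Sg.exList (hS : SigClass S) {P : α → β → Prop}
    (hP : Sg S (fun q : α × β => P q.1 q.2)) {f : α → List β} (hf : Primrec f) :
    Sg S (fun a => ∃ b ∈ f a, P a b) := by
  apply Sg.ex hS
  apply Sg.and hS _ hP
  apply Sg.prim hS
  exact pp_mem (by fun_prop) (by fun_prop)

end SgLemmas

/-! ### Adjoining a function to a Sigma class -/

/-- The first `k` values of `G`. -/
def pre {β : Type*} (G : ℕ → β) (k : ℕ) : List β := (List.range k).map G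

/-- The class obtained from `S` by adjoining the function `G`. -/
def Ext (S : Set (Set ℕ)) {β : Type*} [Primcodable β] (G : ℕ → β) : Set (Set ℕ) :=
  {V | ∃ U : ℕ → List β → Prop, Sg S (fun q : ℕ × List β => U q.1 q.2) ∧
    ∀ n, n ∈ V ↔ ∃ k, U n (pre G k)}

section ExtLemmas

open Encodable

variable {S S' : Set (Set ℕ)} {α β : Type*} [Primcodable α] [Primcodable β] {G : ℕ → β}

@[simp] theorem pre_length (k : ℕ) : (pre G k).length = k := by simp [pre]

@[simp] theorem take_pre (i k : ℕ) : (pre G k).take i = pre G (min i k) := by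
  simp [pre, ← List.map_take, List.take_range]

theorem pre_getElem? (k i : ℕ) : (pre G k)[i]? = if i < k then some (G i) else none := by
  unfold pre
  split_ifs with h
  · simp [h]
  · simp; omega

theorem sg_up (hS : SigClass S) {U : α → List β → Prop}
    (hU : Sg S (fun q : α × List β => U q.1 q.2)) :
    Sg S (fun q : α × List β => ∃ i, U q.1 (q.2.take i)) := by
  apply Sg.ex hS
  exact hU.comp hS (f := fun q : (α × List β) × ℕ => (q.1.1, q.1.2.take q.2)) (by fun_prop)

theorem sg_ext (hS : SigClass S) {U : α → List β → Prop}
    (hU : Sg S (fun q : α × List β => U q.1 q.2)) :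
    Sg (Ext S G) (fun a => ∃ k, U a (pre G k)) := by
  refine ⟨fun n L => ∃ a : α, decode n = some a ∧ U a L, ?_, ?_⟩
  · apply Sg.ex hS
    apply Sg.and hS
    · apply Sg.prim hS
      apply pp_eq _ (by fun_prop)
      exact Primrec.decode.comp (by fun_prop)
    · exact hU.comp hS (f := fun q : (ℕ × List β) × α => (q.2, q.1.2)) (by fun_prop)
  · intro n
    simp only [Set.mem_ofPred_eq]
    constructor
    · rintro ⟨a, h, k, hk⟩; exact ⟨k, a, h, hk⟩
    · rintro ⟨k, a, h, hk⟩; exact ⟨a, h, k, hk⟩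

theorem sub_ext (hS : SigClass S) : S ⊆ Ext S G := by
  intro A hA
  refine ⟨fun n _ => n ∈ A, ?_, fun n => by simp⟩
  have : Sg S (fun n : ℕ => n ∈ A) := sg_nat.2 hA
  exact this.comp hS (f := fun q : ℕ × List β => q.1) (by fun_prop)

theorem ext_graph (hS : SigClass S) : Sg (Ext S G) (fun q : ℕ × β => G q.1 = q.2) := by
  have := sg_ext (G := G) hS (U := fun (q : ℕ × β) L => L[q.1]? = some q.2)
    (Sg.prim hS (by fun_prop))
  refine this.of_eq fun q => ?_
  simp only [pre_getElem?]
  constructor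
  · rintro ⟨k, hk⟩
    split_ifs at hk
    simpa using hk
  · intro h
    exact ⟨q.1 + 1, by simp [h]⟩

theorem ext_sig (hS : SigClass S) : SigClass (Ext S G) where
  cnt := by
    refine (hS.cnt.image (fun A => {n | ∃ k, Nat.pair n (encode (pre G k)) ∈ A})).mono ?_
    rintro V ⟨U, hU, hV⟩
    refine ⟨_, hU, ?_⟩
    ext n
    rw [hV]
    simp only [Set.mem_ofPred_eq]
    refine exists_congr fun k => ?_
    constructor
    · rintro ⟨⟨a, L⟩, hd, h⟩
      simp [Encodable.decode_prod_val] at hd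
      obtain ⟨rfl, rfl⟩ := hd
      exact h
    · intro h
      exact ⟨(n, pre G k), by simp [Encodable.decode_prod_val], h⟩
  prim p hp := sub_ext hS (hS.prim p hp)
  inter := by
    rintro A ⟨U, hU, hA⟩ B ⟨U', hU', hB⟩
    refine ⟨fun n L => (∃ i, U n (L.take i)) ∧ ∃ i, U' n (L.take i),
      Sg.and hS (sg_up hS hU) (sg_up hS hU'), fun n => ?_⟩
    simp only [Set.mem_inter_iff, hA, hB, take_pre]
    constructor
    · rintro ⟨⟨i, hi⟩, ⟨j, hj⟩⟩
      exact ⟨max i j, ⟨i, by simpa using hi⟩, ⟨j, by simpa using hj⟩⟩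
    · rintro ⟨k, ⟨i, hi⟩, ⟨j, hj⟩⟩
      exact ⟨⟨_, hi⟩, ⟨_, hj⟩⟩
  union := by
    rintro A ⟨U, hU, hA⟩ B ⟨U', hU', hB⟩
    refine ⟨fun n L => U n L ∨ U' n L, Sg.or hS hU hU', fun n => ?_⟩
    simp only [Set.mem_union, hA, hB, exists_or]
  proj := by
    rintro A ⟨U, hU, hA⟩
    refine ⟨fun n L => ∃ m, U (Nat.pair n m) L, ?_, fun n => ?_⟩
    · apply Sg.ex hS
      exact hU.comp hS (f := fun q : (ℕ × List β) × ℕ => (Nat.pair q.1.1 q.2, q.1.2)) (by fun_prop)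
    · simp only [Set.mem_ofPred_eq, hA]
      rw [exists_comm]
  comap := by
    rintro h hh A ⟨U, hU, hA⟩
    refine ⟨fun n L => U (h n) L, ?_, fun n => ?_⟩
    · exact hU.comp hS (f := fun q : (ℕ × List β) => (h q.1, q.2)) (by fun_prop)
    · simp only [Set.mem_preimage, hA]
  ball := by
    rintro A ⟨U, hU, hA⟩
    refine ⟨fun n L => ∀ m < n.unpair.2, ∃ i, U (Nat.pair n.unpair.1 m) (L.take i), ?_,
      fun n => ?_⟩
    · apply Sg.ball hS _ (by fun_prop)
      exact (sg_up hS hU).comp hS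
        (f := fun q : (ℕ × List β) × ℕ => (Nat.pair q.1.1.unpair.1 q.2, q.1.2)) (by fun_prop)
    · simp only [Set.mem_ofPred_eq, hA, take_pre]
      constructor
      · intro h
        choose! k hk using h
        refine ⟨(Finset.range n.unpair.2).sup k, fun m hm => ⟨k m, ?_⟩⟩
        rw [min_eq_left]
        · exact hk m hm
        · exact Finset.le_sup (f := k) (Finset.mem_range.2 hm)
      · rintro ⟨k, hk⟩ m hm
        obtain ⟨i, hi⟩ := hk m hm
        exact ⟨_, hi⟩

end ExtLemmas

/-! ### Generic construction -/

theorem generic {S : Set (Set ℕ)} (hS : SigClass S) {V : Set ℕ} {C : Type*}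
    (le : C → C → Prop) (hrefl : ∀ c, le c c) (htrans : ∀ a b c, le a b → le b c → le a c)
    (stem : C → List ℕ) (hst : ∀ c c', le c' c → stem c <+: stem c') (c0 : C)
    (hlen : ∀ c, ∃ c', le c' c ∧ (stem c).length < (stem c').length)
    (hdec : ∀ U : ℕ → List ℕ → Prop, Sg S (fun q : ℕ × List ℕ => U q.1 q.2) → ∀ c, ∃ c', le c' c ∧
      ((∃ n, n ∉ V ∧ U n (stem c')) ∨ ∃ n, n ∈ V ∧ ∀ c'', le c'' c' → ¬ U n (stem c'')))
    {ι : Type*} [Countable ι] (D : ι → C → Prop) (hD : ∀ i c, ∃ c', le c' c ∧ D i c') :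
    ∃ G : ℕ → ℕ, V ∉ Ext S G ∧ ∃ c : ℕ → C, c 0 = c0 ∧ (∀ i j, i ≤ j → le (c j) (c i)) ∧
      (∀ i, stem (c i) = pre G (stem (c i)).length) ∧ (∀ k, ∃ i, k ≤ (stem (c i)).length) ∧
      ∀ j, ∃ i, D j (c i) := by
  classical
  let T0 := {U : ℕ → List ℕ → Prop // Sg S (fun q : ℕ × List ℕ => U q.1 q.2)}
  have hT0 : Countable T0 := by
    have := hS.cnt.to_subtype
    refine Function.Injective.countable (f := fun U : T0 => (⟨_, U.2⟩ : S)) ?_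
    rintro ⟨U, hU⟩ ⟨U', hU'⟩ h
    have h := congrArg Subtype.val h
    apply Subtype.ext
    funext n L
    apply propext
    have h2 := Set.ext_iff.1 h (Encodable.encode (n, L))
    simpa using h2
  have : Nonempty (T0 ⊕ ι) :=
    ⟨Sum.inl ⟨fun _ _ => (0 : ℕ) = 0, Sg.prim hS (by fun_prop)⟩⟩
  obtain ⟨e, he⟩ := exists_surjective_nat (T0 ⊕ ι)
  let Q : T0 ⊕ ι → C → Prop := fun t c => match t with
    | Sum.inl U => ((∃ n, n ∉ V ∧ U.1 n (stem c)) ∨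
        ∃ n, n ∈ V ∧ ∀ c'', le c'' c → ¬ U.1 n (stem c''))
    | Sum.inr i => D i c
  have step : ∀ t c, ∃ c', le c' c ∧ (stem c).length < (stem c').length ∧ Q t c' := by
    intro t c
    obtain ⟨c1, h1, h2⟩ := hlen c
    have : ∃ c', le c' c1 ∧ Q t c' := by
      cases t with
      | inl U => exact hdec U.1 U.2 c1
      | inr i => exact hD i c1
    obtain ⟨c2, h3, h4⟩ := this
    exact ⟨c2, htrans _ _ _ h3 h1, lt_of_lt_of_le h2 (hst _ _ h3).length_le, h4⟩
  choose nx hnx1 hnx2 hnx3 using step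
  obtain ⟨c, hc0, hc⟩ : ∃ c : ℕ → C, c 0 = c0 ∧ ∀ i, c (i + 1) = nx (e i) (c i) :=
    ⟨fun i => Nat.rec c0 (fun i c => nx (e i) c) i, rfl, fun _ => rfl⟩
  have hmono : ∀ i j, i ≤ j → le (c j) (c i) := by
    intro i j hij
    induction hij with
    | refl => exact hrefl _
    | step _ ih => exact htrans _ _ _ (by rw [hc]; exact hnx1 _ _) ih
  have hl : ∀ i, i ≤ (stem (c i)).length := by
    intro i
    induction i with
    | zero => simp
    | succ i ih =>
      have := hnx2 (e i) (c i)
      rw [← hc] at this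
      omega
  let G : ℕ → ℕ := fun n => (stem (c (n + 1))).getD n 0
  have hpre : ∀ i, stem (c i) = pre G (stem (c i)).length := by
    intro i
    apply List.ext_getElem?
    intro n
    rw [pre_getElem?]
    split_ifs with h
    · have hl1 : n < (stem (c (n + 1))).length := hl (n + 1)
      have key : (stem (c i))[n] = (stem (c (n + 1)))[n] := by
        rcases le_total i (n + 1) with h' | h'
        · exact (hst _ _ (hmono _ _ h')).getElem h
        · exact ((hst _ _ (hmono _ _ h')).getElem hl1).symm
      rw [List.getElem?_eq_getElem h, key]
      simp [G, List.getD, hl1]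
    · simpa using h
  refine ⟨G, ?_, c, hc0, hmono, hpre, fun k => ⟨k, hl k⟩, ?_⟩
  · rintro ⟨U, hU, hV⟩
    obtain ⟨i, hi⟩ := he (Sum.inl ⟨fun n L => ∃ i, U n (L.take i), sg_up hS hU⟩)
    have h3 := hnx3 (e i) (c i)
    rw [← hc, hi] at h3
    rcases h3 with ⟨n, hn, j, hj⟩ | ⟨n, hn, h⟩
    · have hj : U n ((stem (c (i + 1))).take j) := hj
      rw [hpre, take_pre] at hj
      exact hn ((hV n).2 ⟨_, hj⟩)
    · obtain ⟨k, hk⟩ := (hV n).1 hn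
      refine h (c (max (i + 1) k)) (hmono _ _ (le_max_left _ _)) ⟨k, ?_⟩
      rw [hpre, take_pre, min_eq_left]
      · exact hk
      · exact le_trans (le_max_right _ _) (hl _)
  · intro j
    obtain ⟨i, hi⟩ := he (Sum.inr j)
    have h3 := hnx3 (e i) (c i)
    rw [← hc, hi] at h3
    exact ⟨i + 1, h3⟩

/-! ### Compactness -/

theorem pre_congr {β : Type*} {p q : ℕ → β} {k : ℕ} (h : ∀ i < k, p i = q i) :
    pre p k = pre q k := by
  unfold pre
  apply List.map_congr_left
  intro a ha
  exact h a (List.mem_range.1 ha)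

theorem isOpen_pre (T : List Bool → Prop) (j : ℕ) : IsOpen {p : ℕ → Bool | T (pre p j)} := by
  have hc : Continuous (fun (p : ℕ → Bool) (i : Fin j) => p i) := by fun_prop
  have h2 : {p : ℕ → Bool | T (pre p j)} =
      (fun (p : ℕ → Bool) (i : Fin j) => p i) ⁻¹' {g | T (List.ofFn g)} := by
    ext p
    have : pre p j = List.ofFn (fun i : Fin j => p i) := by
      apply List.ext_getElem <;> simp [pre]
    simp [this]
  rw [h2]
  exact (isOpen_discrete _).preimage hc

theorem compact_unif (T : List Bool → Prop) (h : ∀ p : ℕ → Bool, ∃ k, T (pre p k)) :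
    ∃ k, ∀ p : ℕ → Bool, ∃ j ≤ k, T (pre p j) := by
  have := isCompact_univ.elim_directed_cover (fun k => {p : ℕ → Bool | ∃ j ≤ k, T (pre p j)})
    (fun k => by
      have : {p : ℕ → Bool | ∃ j ≤ k, T (pre p j)} = ⋃ j ∈ Set.Iic k, {p | T (pre p j)} := by
        ext p; simp
      rw [this]
      exact isOpen_biUnion fun j _ => isOpen_pre T j)
    (fun p _ => by
      obtain ⟨k, hk⟩ := h p
      exact Set.mem_iUnion.2 ⟨k, k, le_rfl, hk⟩)
    (by
      apply Monotone.directed_le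
      intro a b hab p hp
      obtain ⟨j, hj, h⟩ := hp
      exact ⟨j, hj.trans hab, h⟩)
  obtain ⟨k, hk⟩ := this
  exact ⟨k, fun p => hk (Set.mem_univ p)⟩

theorem pr_bits : Primrec (fun q : ℕ × ℕ => pre (Nat.testBit q.1) q.2) := by
  unfold pre
  refine Primrec.list_map (Primrec.list_range.comp Primrec.snd) ?_
  have h : PrimrecPred (fun r : (ℕ × ℕ) × ℕ => r.1.1 / 2 ^ r.2 % 2 = 1) := by fun_prop
  have := h.decide
  refine this.of_eq fun r => ?_
  exact Nat.testBit_eq_decide_div_mod_eq.symm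

theorem sg_compact {S : Set (Set ℕ)} (hS : SigClass S) {α : Type*} [Primcodable α]
    {T : α → List Bool → Prop} (hT : Sg S (fun q : α × List Bool => T q.1 q.2)) :
    Sg S (fun a => ∀ p : ℕ → Bool, ∃ k, T a (pre p k)) := by
  have : Sg S (fun a => ∃ k : ℕ, ∀ m < 2 ^ k, ∃ i, i ≤ k ∧ T a (pre (Nat.testBit m) i)) := by
    apply Sg.ex hS
    apply Sg.ball hS _ (by fun_prop)
    apply Sg.ex hS
    apply Sg.and hS (Sg.prim hS (by fun_prop))
    refine hT.comp hS (f := fun q : ((α × ℕ) × ℕ) × ℕ => (q.1.1.1, pre (Nat.testBit q.1.2) q.2)) ?_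
    exact Primrec.pair (by fun_prop) (pr_bits.comp (g := fun q : ((α × ℕ) × ℕ) × ℕ => (q.1.2, q.2))
      (by fun_prop))
  refine this.of_eq fun a => ?_
  constructor
  · rintro ⟨k, hk⟩ p
    obtain ⟨i, hi, h⟩ := hk (Nat.ofBits fun i : Fin k => p i) (Nat.ofBits_lt_two_pow _)
    refine ⟨i, ?_⟩
    rwa [pre_congr (q := p)] at h
    intro j hj
    rw [Nat.testBit_ofBits_lt _ _ (by omega)]
  · intro h
    obtain ⟨k, hk⟩ := compact_unif _ h
    exact ⟨k, fun m _ => hk _⟩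

theorem ne_cases {S : Set (Set ℕ)} {A V : Set ℕ} (hA : A ∈ S) (hV : V ∉ S) :
    (∃ n, n ∈ A ∧ n ∉ V) ∨ ∃ n, n ∈ V ∧ n ∉ A := by
  by_contra hc
  push Not at hc
  have h : A ≠ V := fun h => hV (h ▸ hA)
  exact h (Set.ext fun n => ⟨hc.1 n, hc.2 n⟩)

/-- Cone avoiding basis theorem. -/
theorem basis {S : Set (Set ℕ)} (hS : SigClass S) {V : Set ℕ} (hV : V ∉ S)
    {T : List Bool → Prop} (hT : Sg S T) (hne : ¬ ∀ p : ℕ → Bool, ∃ k, T (pre p k)) :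
    ∃ p : ℕ → Bool, V ∉ Ext S p ∧ ∀ k, ¬ T (pre p k) := by
  classical
  let T0 := {U : ℕ → List Bool → Prop // Sg S (fun q : ℕ × List Bool => U q.1 q.2)}
  have hT0 : Countable T0 := by
    have := hS.cnt.to_subtype
    refine Function.Injective.countable (f := fun U : T0 => (⟨_, U.2⟩ : S)) ?_
    rintro ⟨U, hU⟩ ⟨U', hU'⟩ h
    have h := congrArg Subtype.val h
    apply Subtype.ext
    funext n L
    apply propext
    have h2 := Set.ext_iff.1 h (Encodable.encode (n, L))
    simpa using h2
  have : Nonempty T0 := ⟨⟨fun _ _ => (0 : ℕ) = 0, Sg.prim hS (by fun_prop)⟩⟩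
  obtain ⟨e, he⟩ := exists_surjective_nat T0
  let C := {T : List Bool → Prop // Sg S T ∧ ¬ ∀ p : ℕ → Bool, ∃ k, T (pre p k)}
  have step : ∀ (U : T0) (c : C), ∃ c' : C, (∀ σ, c.1 σ → c'.1 σ) ∧
      ((∃ n, n ∉ V ∧ ∀ p : ℕ → Bool, (∀ k, ¬ c'.1 (pre p k)) → ∃ k, U.1 n (pre p k)) ∨
       (∃ n, n ∈ V ∧ ∀ p : ℕ → Bool, (∀ k, ¬ c'.1 (pre p k)) → ∀ k, ¬ U.1 n (pre p k))) := by
    rintro ⟨U, hU⟩ ⟨T, hT, hne⟩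
    have h1 : Sg S (fun n : ℕ => ∀ p : ℕ → Bool, ∃ k, (T (pre p k) ∨ U n (pre p k))) := by
      apply sg_compact hS (T := fun n σ => T σ ∨ U n σ)
      exact Sg.or hS (hT.comp hS (f := fun q : ℕ × List Bool => q.2) (by fun_prop)) hU
    rw [sg_nat] at h1
    rcases ne_cases h1 hV with ⟨n, hn, hn'⟩ | ⟨n, hn, hn'⟩
    · refine ⟨⟨T, hT, hne⟩, fun _ h => h, Or.inl ⟨n, hn', fun p hp => ?_⟩⟩
      obtain ⟨k, hk | hk⟩ := hn p
      · exact absurd hk (hp k)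
      · exact ⟨k, hk⟩
    · refine ⟨⟨fun σ => T σ ∨ U n σ, ?_, hn'⟩, fun _ h => Or.inl h, Or.inr ⟨n, hn, fun p hp k hk => ?_⟩⟩
      · exact Sg.or hS hT (hU.comp hS (f := fun σ : List Bool => (n, σ)) (by fun_prop))
      · exact hp k (Or.inr hk)
  choose nx hnx1 hnx2 using step
  obtain ⟨c, hc0, hc⟩ : ∃ c : ℕ → C, c 0 = ⟨T, hT, hne⟩ ∧ ∀ i, c (i + 1) = nx (e i) (c i) :=
    ⟨fun i => Nat.rec ⟨T, hT, hne⟩ (fun i c => nx (e i) c) i, rfl, fun _ => rfl⟩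
  have hinter := IsCompact.nonempty_iInter_of_sequence_nonempty_isCompact_isClosed
    (fun i => {p : ℕ → Bool | ∀ k, ¬ (c i).1 (pre p k)})
    (fun i p hp k hk => hp k (by rw [hc]; exact hnx1 _ _ _ hk))
    (fun i => by
      have := (c i).2.2
      push Not at this
      exact this)
    (by
      apply IsClosed.isCompact
      have : {p : ℕ → Bool | ∀ k, ¬ (c 0).1 (pre p k)} =
        ⋂ k, {p : ℕ → Bool | (c 0).1 (pre p k)}ᶜ := by ext; simp
      rw [this]
      exact isClosed_iInter fun k => (isOpen_pre _ k).isClosed_compl)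
    (fun i => by
      have : {p : ℕ → Bool | ∀ k, ¬ (c i).1 (pre p k)} =
        ⋂ k, {p : ℕ → Bool | (c i).1 (pre p k)}ᶜ := by ext; simp
      rw [this]
      exact isClosed_iInter fun k => (isOpen_pre _ k).isClosed_compl)
  obtain ⟨p, hp⟩ := hinter
  have hp : ∀ i k, ¬ (c i).1 (pre p k) := by simpa using hp
  refine ⟨p, ?_, fun k => ?_⟩
  · rintro ⟨U, hU, hV⟩
    obtain ⟨i, hi⟩ := he ⟨U, hU⟩
    have h3 := hnx2 (e i) (c i)
    rw [← hc, hi] at h3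
    rcases h3 with ⟨n, hn, h⟩ | ⟨n, hn, h⟩
    · exact hn ((hV n).2 (h p (hp _)))
    · obtain ⟨k, hk⟩ := (hV n).1 hn
      exact h p (hp _) k hk
  · have := hp 0 k
    rwa [hc0] at this

/-- Either a uniform positive answer outside `V`, or a cone avoiding counterexample. -/
theorem lemG {S : Set (Set ℕ)} (hS : SigClass S) {V : Set ℕ} (hV : V ∉ S)
    {T : ℕ → List Bool → Prop} (hT : Sg S (fun q : ℕ × List Bool => T q.1 q.2)) :
    (∃ n, n ∉ V ∧ ∃ k, ∀ p : ℕ → Bool, ∃ j ≤ k, T n (pre p j)) ∨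
    (∃ n, n ∈ V ∧ ∃ p : ℕ → Bool, V ∉ Ext S p ∧ ∀ k, ¬ T n (pre p k)) := by
  have h1 := sg_compact hS hT
  rw [sg_nat] at h1
  rcases ne_cases h1 hV with ⟨n, hn, hn'⟩ | ⟨n, hn, hn'⟩
  · exact Or.inl ⟨n, hn', compact_unif _ hn⟩
  · refine Or.inr ⟨n, hn, basis hS hV ?_ hn'⟩
    exact hT.comp hS (f := fun σ : List Bool => (n, σ)) (by fun_prop)

/-! ### Increasing lists and Mathias style extensions -/

/-- `L` is an increasing list. -/
def Inc (L : List ℕ) : Prop := L.Pairwise (· < ·)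

section Basic

variable {S : Set (Set ℕ)} {V : Set ℕ} {α : Type*} [Primcodable α]

theorem sg_inc (hS : SigClass S) : Sg S Inc := by
  have : Sg S (fun L : List ℕ => ∀ i < L.length, ∀ j < L.length, i < j →
      ∃ a b, L[i]? = some a ∧ L[j]? = some b ∧ a < b) := by
    apply Sg.ball hS _ (by fun_prop)
    apply Sg.ball hS _ (by fun_prop)
    apply Sg.imp hS (by fun_prop)
    apply Sg.ex hS
    apply Sg.ex hS
    apply Sg.prim hS
    fun_prop
  refine this.of_eq fun L => ?_
  unfold Inc
  rw [List.pairwise_iff_getElem]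
  constructor
  · intro h i j hi hj hij
    obtain ⟨a, b, ha, hb, hab⟩ := h i hi j hj hij
    rw [List.getElem?_eq_getElem hi] at ha
    rw [List.getElem?_eq_getElem hj] at hb
    cases ha; cases hb
    exact hab
  · intro h i hi j hj hij
    exact ⟨_, _, List.getElem?_eq_getElem hi, List.getElem?_eq_getElem hj, h i j hi hj hij⟩

theorem sg_mem (hS : SigClass S) {X : Set ℕ} (hX : X ∈ S) {f : α → ℕ} (hf : Primrec f) :
    Sg S (fun a => f a ∈ X) := by
  have : Sg S (fun n : ℕ => n ∈ X) := sg_nat.2 hX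
  exact this.comp hS hf

/-- The set of numerical elements of `E` is contained in `X` and `E` is increasing. -/
def IncIn (X : Set ℕ) (E : List ℕ) : Prop := Inc E ∧ ∀ e ∈ E, e ∈ X

theorem sg_incIn (hS : SigClass S) {X : Set ℕ} (hX : X ∈ S) : Sg S (IncIn X) := by
  apply Sg.and hS (sg_inc hS)
  apply Sg.ballList hS (sg_mem hS hX (by fun_prop)) (by fun_prop)

theorem IncIn.mono {X Y : Set ℕ} (h : X ⊆ Y) {E : List ℕ} (hE : IncIn X E) : IncIn Y E :=
  ⟨hE.1, fun e he => h (hE.2 e he)⟩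

theorem mem_above (hS : SigClass S) {X : Set ℕ} (hX : X ∈ S) (b : ℕ) : {z ∈ X | b < z} ∈ S :=
  hS.inter _ hX _ (hS.prim (fun z => b < z) (by fun_prop))

theorem inf_above {X : Set ℕ} (hX : X.Infinite) (b : ℕ) : {z ∈ X | b < z}.Infinite := by
  have : {z ∈ X | b < z} = X \ Set.Iic b := by ext; simp
  rw [this]
  exact hX.sdiff (Set.finite_Iic b)

theorem list_bound (L : List ℕ) : ∃ b, ∀ e ∈ L, e ≤ b :=
  ⟨L.sum, fun _ he => List.le_sum_of_mem he⟩

theorem inc_append {F E : List ℕ} {X : Set ℕ} (hF : Inc F) (hFX : ∀ a ∈ F, ∀ x ∈ X, a < x)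
    (hE : IncIn X E) : Inc (F ++ E) :=
  List.pairwise_append.2 ⟨hF, hE.1, fun a ha e he => hFX a ha e (hE.2 e he)⟩

theorem incIn_single {X : Set ℕ} {x : ℕ} (hx : x ∈ X) : IncIn X [x] :=
  ⟨List.pairwise_singleton _ _, by simpa using hx⟩

theorem incIn_nil {X : Set ℕ} : IncIn X [] := ⟨List.Pairwise.nil, by simp⟩

/-- Extract an infinite set from the generic function. -/
theorem range_facts {G : ℕ → ℕ} {ℓ : ℕ → List ℕ} (hinc : ∀ i, Inc (ℓ i))
    (hpre : ∀ i, ℓ i = pre G (ℓ i).length) (hl : ∀ k, ∃ i, k ≤ (ℓ i).length) :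
    StrictMono G ∧ ∀ k, ∃ i, G k ∈ ℓ i := by
  constructor
  · intro a b hab
    obtain ⟨i, hi⟩ := hl (b + 1)
    have h := hinc i
    rw [hpre i] at h
    unfold Inc at h
    rw [List.pairwise_iff_getElem] at h
    have := h a b (by simp; omega) (by simp; omega) hab
    simpa [pre] using this
  · intro k
    obtain ⟨i, hi⟩ := hl (k + 1)
    refine ⟨i, ?_⟩
    rw [hpre i]
    simp only [pre, List.mem_map, List.mem_range]
    exact ⟨k, by omega, rfl⟩

theorem range_mem_ext (hS : SigClass S) {G : ℕ → ℕ} : Set.range G ∈ Ext S G := by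
  have h : Sg (Ext S G) (fun n : ℕ => ∃ k : ℕ, G k = n) := by
    apply Sg.ex (ext_sig hS)
    exact (ext_graph hS).comp (ext_sig hS) (f := fun q : ℕ × ℕ => (q.2, q.1)) (by fun_prop)
  exact sg_nat.1 h

theorem compl_range_mem_ext (hS : SigClass S) {G : ℕ → ℕ} (hG : StrictMono G) :
    (Set.range G)ᶜ ∈ Ext S G := by
  have h : Sg (Ext S G) (fun n : ℕ => ∃ k : ℕ, n ∉ pre G k ∧ ∃ y ∈ pre G k, n < y) := by
    apply sg_ext hS (U := fun n L => n ∉ L ∧ ∃ y ∈ L, n < y)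
    apply Sg.and hS
    · exact Sg.prim hS (pp_mem (by fun_prop) (by fun_prop)).not
    · exact Sg.exList hS (Sg.prim hS (by fun_prop)) (by fun_prop)
  rw [sg_nat] at h
  convert h using 1
  ext n
  simp only [pre, List.mem_map, List.mem_range]
  constructor
  · intro hn
    refine ⟨n + 2, ?_, G (n + 1), ⟨n + 1, by omega, rfl⟩, ?_⟩
    · rintro ⟨a, -, rfl⟩; exact hn ⟨a, rfl⟩
    · exact lt_of_lt_of_le (Nat.lt_succ_self n) (hG.le_apply)
  · rintro ⟨k, h1, y, ⟨i, hi, rfl⟩, hy⟩ ⟨j, rfl⟩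
    exact h1 ⟨j, (hG.lt_iff_lt.1 hy).trans hi, rfl⟩

/-- A cone avoiding path through a `Σ` set of lists without dead ends. -/
theorem path (hS : SigClass S) (hV : V ∉ S) {Q : List ℕ → Prop} (hQ : Sg S Q) (L0 : List ℕ)
    (hL0 : Q L0) (hext : ∀ q, Q q → ∃ E, Q (q ++ E) ∧ E ≠ []) :
    ∃ G : ℕ → ℕ, V ∉ Ext S G ∧ ∃ ℓ : ℕ → List ℕ, (∀ i, Q (ℓ i)) ∧
      (∀ i, ℓ i = pre G (ℓ i).length) ∧ (∀ k, ∃ i, k ≤ (ℓ i).length) := by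
  obtain ⟨G, hG, c, -, -, h1, h2, -⟩ := generic hS (V := V) (C := {L // Q L})
    (fun c' c => c.1 <+: c'.1) (fun _ => List.prefix_rfl) (fun _ _ _ h1 h2 => h2.trans h1)
    (fun c => c.1) (fun _ _ h => h) ⟨L0, hL0⟩
    (by
      rintro ⟨q, hq⟩
      obtain ⟨E, hE, hne⟩ := hext q hq
      refine ⟨⟨q ++ E, hE⟩, List.prefix_append _ _, ?_⟩
      have := List.length_pos_iff.2 hne
      simp; omega)
    (by
      rintro U hU ⟨q, hq⟩
      have h : Sg S (fun n : ℕ => ∃ E, Q (q ++ E) ∧ U n (q ++ E)) := by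
        apply Sg.ex hS
        apply Sg.and hS
        · exact hQ.comp hS (f := fun r : ℕ × List ℕ => q ++ r.2) (by fun_prop)
        · exact hU.comp hS (f := fun r : ℕ × List ℕ => (r.1, q ++ r.2)) (by fun_prop)
      rw [sg_nat] at h
      rcases ne_cases h hV with ⟨n, ⟨E, hE, hU⟩, hn'⟩ | ⟨n, hn, hn'⟩
      · exact ⟨⟨q ++ E, hE⟩, List.prefix_append _ _, Or.inl ⟨n, hn', hU⟩⟩
      · refine ⟨⟨q, hq⟩, List.prefix_rfl, Or.inr ⟨n, hn, ?_⟩⟩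
        rintro ⟨q', hq'⟩ ⟨E, rfl⟩ hU
        exact hn' ⟨E, hq', hU⟩)
    (ι := Empty) (fun _ _ => True) (fun i => i.elim)
  exact ⟨G, hG, fun i => (c i).1, fun i => (c i).2, h1, h2⟩

end Basic

/-! ### Cohesiveness -/

section Coh

variable {S : Set (Set ℕ)} {V : Set ℕ}

/-- Mathias conditions. -/
structure MC (S : Set (Set ℕ)) where
  F : List ℕ
  X : Set ℕ
  mem : X ∈ S
  inf : X.Infinite
  inc : Inc F
  lt : ∀ a ∈ F, ∀ x ∈ X, a < x

theorem sg_mathias (hS : SigClass S) {X : Set ℕ} (hX : X ∈ S) (F : List ℕ)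
    {U : ℕ → List ℕ → Prop} (hU : Sg S (fun q : ℕ × List ℕ => U q.1 q.2)) :
    Sg S (fun n : ℕ => ∃ E, IncIn X E ∧ U n (F ++ E)) := by
  apply Sg.ex hS
  apply Sg.and hS
  · exact (sg_incIn hS hX).comp hS (f := fun q : ℕ × List ℕ => q.2) (by fun_prop)
  · exact hU.comp hS (f := fun q : ℕ × List ℕ => (q.1, F ++ q.2)) (by fun_prop)

theorem coh (hS : SigClass S) (hV : V ∉ S) {ι : Type*} [Countable ι] (R : ι → Set ℕ)
    (hR : ∀ i, R i ∈ S) (hRc : ∀ i, (R i)ᶜ ∈ S) :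
    ∃ S', SigClass S' ∧ S ⊆ S' ∧ V ∉ S' ∧ ∃ X ∈ S', X.Infinite ∧
      ∀ i, ∃ b, (∀ x ∈ X, b < x → x ∈ R i) ∨ (∀ x ∈ X, b < x → x ∉ R i) := by
  obtain ⟨G, hG, c, -, hmono, hpre, hl, hD⟩ := generic hS (V := V) (C := MC S)
    (fun c' c => (∃ E, c'.F = c.F ++ E ∧ IncIn c.X E) ∧ c'.X ⊆ c.X)
    (fun c => ⟨⟨[], by simp, incIn_nil⟩, subset_rfl⟩)
    (by
      rintro a b c ⟨⟨E1, h1, h1'⟩, h2⟩ ⟨⟨E2, h3, h3'⟩, h4⟩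
      refine ⟨⟨E2 ++ E1, by rw [h1, h3, List.append_assoc], ?_, ?_⟩, h2.trans h4⟩
      · have := a.inc
        rw [h1, h3, List.append_assoc] at this
        exact (List.pairwise_append.1 this).2.1
      · intro e he
        rcases List.mem_append.1 he with he | he
        · exact h3'.2 e he
        · exact h4 (h1'.2 e he))
    (fun c => c.F) (by rintro c c' ⟨⟨E, h, -⟩, -⟩; rw [h]; exact List.prefix_append _ _)
    ⟨[], Set.univ, by simpa using hS.prim (fun _ => (0 : ℕ) = 0) (by fun_prop),
      Set.infinite_univ, List.Pairwise.nil, by simp⟩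
    (by
      intro c
      obtain ⟨x, hx⟩ := c.inf.nonempty
      refine ⟨⟨c.F ++ [x], {z ∈ c.X | x < z}, mem_above hS c.mem x, inf_above c.inf x,
        inc_append c.inc c.lt (incIn_single hx), ?_⟩, ⟨⟨[x], rfl, incIn_single hx⟩,
          fun z hz => hz.1⟩, by simp⟩
      intro a ha z hz
      rcases List.mem_append.1 ha with ha | ha
      · exact c.lt a ha z hz.1
      · rw [List.mem_singleton.1 ha]; exact hz.2)
    (by
      intro U hU c
      have h := sg_mathias hS c.mem c.F hU
      rw [sg_nat] at h
      rcases ne_cases h hV with ⟨n, ⟨E, hE, hU⟩, hn'⟩ | ⟨n, hn, hn'⟩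
      · obtain ⟨b, hb⟩ := list_bound E
        refine ⟨⟨c.F ++ E, {z ∈ c.X | b < z}, mem_above hS c.mem b, inf_above c.inf b,
          inc_append c.inc c.lt hE, ?_⟩, ⟨⟨E, rfl, hE⟩, fun z hz => hz.1⟩, Or.inl ⟨n, hn', hU⟩⟩
        intro a ha z hz
        rcases List.mem_append.1 ha with ha | ha
        · exact c.lt a ha z hz.1
        · exact (hb a ha).trans_lt hz.2
      · refine ⟨c, ⟨⟨[], by simp, incIn_nil⟩, subset_rfl⟩, Or.inr ⟨n, hn, ?_⟩⟩
        rintro c' ⟨⟨E, h, hE⟩, -⟩ hU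
        exact hn' ⟨E, hE, h ▸ hU⟩)
    (fun i c => c.X ⊆ R i ∨ c.X ⊆ (R i)ᶜ)
    (by
      intro i c
      have : (c.X ∩ R i).Infinite ∨ (c.X ∩ (R i)ᶜ).Infinite := by
        rw [← Set.infinite_union, ← Set.inter_union_distrib_left, Set.union_compl_self,
          Set.inter_univ]
        exact c.inf
      rcases this with h | h
      · exact ⟨⟨c.F, c.X ∩ R i, hS.inter _ c.mem _ (hR i), h, c.inc,
          fun a ha x hx => c.lt a ha x hx.1⟩, ⟨⟨[], by simp, incIn_nil⟩, Set.inter_subset_left⟩,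
          Or.inl Set.inter_subset_right⟩
      · exact ⟨⟨c.F, c.X ∩ (R i)ᶜ, hS.inter _ c.mem _ (hRc i), h, c.inc,
          fun a ha x hx => c.lt a ha x hx.1⟩, ⟨⟨[], by simp, incIn_nil⟩, Set.inter_subset_left⟩,
          Or.inr Set.inter_subset_right⟩)
  obtain ⟨hGm, hGl⟩ := range_facts (fun i => (c i).inc) hpre hl
  refine ⟨Ext S G, ext_sig hS, sub_ext hS, hG, Set.range G, range_mem_ext hS,
    Set.infinite_range_of_injective hGm.injective, fun i => ?_⟩
  obtain ⟨j, hj⟩ := hD i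
  obtain ⟨b, hb⟩ := list_bound (c j).F
  have key : ∀ x ∈ Set.range G, b < x → x ∈ (c j).X := by
    rintro _ ⟨k, rfl⟩ hk
    obtain ⟨i, hi⟩ := hGl k
    rcases le_total i j with h | h
    · obtain ⟨⟨E, h, -⟩, -⟩ := hmono _ _ h
      have := hb (G k) (by rw [h]; exact List.mem_append_left _ hi)
      omega
    · obtain ⟨⟨E, h, hE⟩, -⟩ := hmono _ _ h
      rw [h] at hi
      rcases List.mem_append.1 hi with hi | hi
      · have := hb (G k) hi
        omega
      · exact hE.2 _ hi
  refine ⟨b, hj.imp (fun h x hx hbx => h (key x hx hbx)) (fun h x hx hbx => h (key x hx hbx))⟩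

end Coh

/-! ### Strong cone avoidance for partitions of `ℕ` -/

section DJ

variable {S : Set (Set ℕ)} {V : Set ℕ}

/-- Mathias conditions with varying classes, stems contained in `R`. -/
structure DC (S : Set (Set ℕ)) (V R X0 : Set ℕ) where
  C : Set (Set ℕ)
  sig : SigClass C
  sub : S ⊆ C
  nmem : V ∉ C
  F : List ℕ
  X : Set ℕ
  mem : X ∈ C
  inf : X.Infinite
  subX : X ⊆ X0
  inc : IncIn (X0 ∩ R) F
  lt : ∀ a ∈ F, ∀ x ∈ X, a < x

theorem dj1 (hS : SigClass S) (hV : V ∉ S) {X0 R : Set ℕ} (hX0 : X0 ∈ S) (hinf : X0.Infinite)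
    (hno : ∀ S', SigClass S' → S ⊆ S' → V ∉ S' → ∀ Y ∈ S', Y.Infinite → Y ⊆ X0 →
      ¬ Y ⊆ R ∧ ¬ Y ⊆ Rᶜ) :
    ∃ S', SigClass S' ∧ S ⊆ S' ∧ V ∉ S' ∧ ∃ X ∈ S', X.Infinite ∧ X ⊆ X0 ∧ ∃ F : List ℕ,
      ∃ U : ℕ → List ℕ → Prop, Sg S' (fun q : ℕ × List ℕ => U q.1 q.2) ∧
      (∀ n E, IncIn (X ∩ R) E → U n (F ++ E) → n ∈ V) ∧
      (∀ S'', SigClass S'' → S' ⊆ S'' → V ∉ S'' → ∀ Y ∈ S'', Y.Infinite → Y ⊆ X → ∀ n ∈ V,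
        ∃ E, IncIn (Y ∩ R) E ∧ U n (F ++ E)) := by
  by_contra hcon
  have happ : ∀ (c : DC S V R X0) (E : List ℕ), IncIn (c.X ∩ R) E →
      IncIn (X0 ∩ R) (c.F ++ E) := by
    intro c E hE
    refine ⟨inc_append c.inc.1 c.lt (hE.mono Set.inter_subset_left), ?_⟩
    intro e he
    rcases List.mem_append.1 he with he | he
    · exact c.inc.2 e he
    · exact ⟨c.subX (hE.2 e he).1, (hE.2 e he).2⟩
  have hnew : ∀ (c : DC S V R X0) (E : List ℕ), IncIn (c.X ∩ R) E →
      ∃ c' : DC S V R X0, c'.F = c.F ++ E ∧ c'.X ⊆ c.X := by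
    intro c E hE
    obtain ⟨b, hb⟩ := list_bound E
    refine ⟨⟨c.C, c.sig, c.sub, c.nmem, c.F ++ E, {z ∈ c.X | b < z}, mem_above c.sig c.mem b,
      inf_above c.inf b, fun z hz => c.subX hz.1, happ c E hE, ?_⟩, rfl, fun z hz => hz.1⟩
    intro a ha z hz
    rcases List.mem_append.1 ha with ha | ha
    · exact c.lt a ha z hz.1
    · exact (hb a ha).trans_lt hz.2
  obtain ⟨G, hG, c, -, hmono, hpre, hl, hD⟩ := generic hS (V := V) (C := DC S V R X0)
    (fun c' c => (∃ E, c'.F = c.F ++ E ∧ IncIn (c.X ∩ R) E) ∧ c'.X ⊆ c.X)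
    (fun c => ⟨⟨[], by simp, incIn_nil⟩, subset_rfl⟩)
    (by
      rintro a b c ⟨⟨E1, h1, h1'⟩, h2⟩ ⟨⟨E2, h3, h3'⟩, h4⟩
      refine ⟨⟨E2 ++ E1, by rw [h1, h3, List.append_assoc], ?_, ?_⟩, h2.trans h4⟩
      · have := a.inc.1
        rw [h1, h3, List.append_assoc] at this
        exact (List.pairwise_append.1 this).2.1
      · intro e he
        rcases List.mem_append.1 he with he | he
        · exact h3'.2 e he
        · exact ⟨h4 (h1'.2 e he).1, (h1'.2 e he).2⟩)
    (fun c => c.F) (by rintro c c' ⟨⟨E, h, -⟩, -⟩; rw [h]; exact List.prefix_append _ _)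
    ⟨S, hS, subset_rfl, hV, [], X0, hX0, hinf, subset_rfl, incIn_nil, by simp⟩
    (by
      intro c
      have h := (hno c.C c.sig c.sub c.nmem c.X c.mem c.inf c.subX).2
      rw [Set.not_subset] at h
      obtain ⟨x, hx, hxR⟩ := h
      have hxE : IncIn (c.X ∩ R) [x] := incIn_single ⟨hx, not_not.1 hxR⟩
      obtain ⟨c', h1, h2⟩ := hnew c [x] hxE
      exact ⟨c', ⟨⟨[x], h1, hxE⟩, h2⟩, by simp [h1]⟩)
    (by
      intro U hU c
      by_cases ha : ∀ n E, IncIn (c.X ∩ R) E → U n (c.F ++ E) → n ∈ V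
      · by_cases hb : ∀ S'', SigClass S'' → c.C ⊆ S'' → V ∉ S'' → ∀ Y ∈ S'', Y.Infinite →
            Y ⊆ c.X → ∀ n ∈ V, ∃ E, IncIn (Y ∩ R) E ∧ U n (c.F ++ E)
        · exact absurd ⟨c.C, c.sig, c.sub, c.nmem, c.X, c.mem, c.inf, c.subX, c.F, U,
            hU.mono c.sub, ha, hb⟩ hcon
        · push Not at hb
          obtain ⟨S'', hS'', hsub, hV'', Y, hY, hYinf, hYX, n, hn, h⟩ := hb
          refine ⟨⟨S'', hS'', c.sub.trans hsub, hV'', c.F, Y, hY, hYinf, hYX.trans c.subX,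
            c.inc, fun a ha x hx => c.lt a ha x (hYX hx)⟩, ⟨⟨[], by simp, incIn_nil⟩, hYX⟩,
            Or.inr ⟨n, hn, ?_⟩⟩
          rintro c'' ⟨⟨E, h1, hE⟩, -⟩ hU
          exact h E hE (h1 ▸ hU)
      · push Not at ha
        obtain ⟨n, E, hE, hU, hn⟩ := ha
        obtain ⟨c', h1, h2⟩ := hnew c E hE
        exact ⟨c', ⟨⟨E, h1, hE⟩, h2⟩, Or.inl ⟨n, hn, h1 ▸ hU⟩⟩)
    (ι := Empty) (fun _ _ => True) (fun i => i.elim)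
  obtain ⟨hGm, hGl⟩ := range_facts (fun i => (c i).inc.1) hpre hl
  have hsub : Set.range G ⊆ X0 ∩ R := by
    rintro _ ⟨k, rfl⟩
    obtain ⟨i, hi⟩ := hGl k
    exact (c i).inc.2 _ hi
  exact (hno _ (ext_sig hS) (sub_ext hS) hG _ (range_mem_ext hS)
    (Set.infinite_range_of_injective hGm.injective) (hsub.trans Set.inter_subset_left)).1
    (hsub.trans Set.inter_subset_right)

theorem pre_big (p : ℕ → Bool) (E : List ℕ) (b : Bool) (h : ∀ x ∈ E, p x = b) :
    ∃ k, ∀ x ∈ E, (pre p k)[x]? = some b := by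
  obtain ⟨k, hk⟩ := list_bound E
  refine ⟨k + 1, fun x hx => ?_⟩
  rw [pre_getElem?, if_pos (by have := hk x hx; omega), h x hx]

theorem pre_val {p : ℕ → Bool} {k x : ℕ} {b : Bool} (h : (pre p k)[x]? = some b) : p x = b := by
  rw [pre_getElem?] at h
  split_ifs at h
  simpa using h

theorem dj (hS : SigClass S) (hV : V ∉ S) {X : Set ℕ} (hX : X ∈ S) (hinf : X.Infinite)
    (R : Set ℕ) :
    ∃ S', SigClass S' ∧ S ⊆ S' ∧ V ∉ S' ∧ ∃ Y ∈ S', Y.Infinite ∧ Y ⊆ X ∧ (Y ⊆ R ∨ Y ⊆ Rᶜ) := by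
  classical
  by_contra hcon
  have hno : ∀ S', SigClass S' → S ⊆ S' → V ∉ S' → ∀ Y ∈ S', Y.Infinite → Y ⊆ X →
      ¬ Y ⊆ R ∧ ¬ Y ⊆ Rᶜ := by
    intro S' h1 h2 h3 Y h4 h5 h6
    constructor
    · exact fun h7 => hcon ⟨S', h1, h2, h3, Y, h4, h5, h6, Or.inl h7⟩
    · exact fun h7 => hcon ⟨S', h1, h2, h3, Y, h4, h5, h6, Or.inr h7⟩
  obtain ⟨S0, hS0, hSS0, hV0, X0, hX0, hi0, hsX0, F0, U0, hU0, ha0, hb0⟩ :=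
    dj1 hS hV hX hinf hno
  obtain ⟨S1, hS1, hSS1, hV1, X1, hX1, hi1, hsX1, F1, U1, hU1, ha1, hb1⟩ :=
    dj1 (R := Rᶜ) hS0 hV0 hX0 hi0 (fun S' h1 h2 h3 Y h4 h5 h6 => by
      rw [compl_compl]
      exact (hno S' h1 (hSS0.trans h2) h3 Y h4 h5 (h6.trans hsX0)).symm)
  have hsg : ∀ (b : Bool) (F : List ℕ) (U : ℕ → List ℕ → Prop),
      Sg S1 (fun q : ℕ × List ℕ => U q.1 q.2) →
      Sg S1 (fun q : ℕ × List Bool =>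
        ∃ E, IncIn X1 E ∧ (∀ x ∈ E, q.2[x]? = some b) ∧ U q.1 (F ++ E)) := by
    intro b F U hU
    apply Sg.ex hS1
    apply Sg.and hS1
    · exact (sg_incIn hS1 hX1).comp hS1 (f := fun q : (ℕ × List Bool) × List ℕ => q.2)
        (by fun_prop)
    apply Sg.and hS1
    · apply Sg.ballList hS1 _ (by fun_prop)
      exact Sg.prim hS1 (by fun_prop)
    · exact hU.comp hS1 (f := fun q : (ℕ × List Bool) × List ℕ => (q.1.1, F ++ q.2))
        (by fun_prop)
  have hT := Sg.or hS1 (hsg true F0 U0 (hU0.mono hSS1)) (hsg false F1 U1 hU1)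
  rcases lemG hS1 hV1 (T := fun n σ =>
    (∃ E, IncIn X1 E ∧ (∀ x ∈ E, σ[x]? = some true) ∧ U0 n (F0 ++ E)) ∨
    (∃ E, IncIn X1 E ∧ (∀ x ∈ E, σ[x]? = some false) ∧ U1 n (F1 ++ E))) hT with
    ⟨n, hn, k, hk⟩ | ⟨n, hn, p, hp, hno⟩
  · obtain ⟨j, -, ⟨E, hE, hR, hU⟩ | ⟨E, hE, hR, hU⟩⟩ := hk (fun x => decide (x ∈ R))
    · refine hn (ha0 n E ⟨hE.1, fun e he => ⟨hsX1 (hE.2 e he), ?_⟩⟩ hU)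
      simpa using pre_val (hR e he)
    · refine hn (ha1 n E ⟨hE.1, fun e he => ⟨hE.2 e he, ?_⟩⟩ hU)
      simpa using pre_val (hR e he)
  · have hmem : ∀ b : Bool, {x ∈ X1 | p x = b} ∈ Ext S1 p := by
      intro b
      apply (ext_sig hS1).inter _ (sub_ext hS1 hX1)
      apply sg_nat.1
      exact (ext_graph hS1).comp (ext_sig hS1) (f := fun x : ℕ => (x, b)) (by fun_prop)
    have : {x ∈ X1 | p x = true}.Infinite ∨ {x ∈ X1 | p x = false}.Infinite := by
      rw [← Set.infinite_union]
      refine hi1.mono fun x hx => ?_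
      cases h : p x
      · exact Or.inr ⟨hx, h⟩
      · exact Or.inl ⟨hx, h⟩
    rcases this with h | h
    · obtain ⟨E, hE, hU⟩ := hb0 _ (ext_sig hS1) (hSS1.trans (sub_ext hS1)) hp _ (hmem true) h
        (fun x hx => hsX1 hx.1) n hn
      obtain ⟨k, hk⟩ := pre_big p E true (fun x hx => (hE.2 x hx).1.2)
      exact hno k (Or.inl ⟨E, hE.mono (fun x hx => hx.1.1), hk, hU⟩)
    · obtain ⟨E, hE, hU⟩ := hb1 _ (ext_sig hS1) (sub_ext hS1) hp _ (hmem false) h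
        (fun x hx => hx.1) n hn
      obtain ⟨k, hk⟩ := pre_big p E false (fun x hx => (hE.2 x hx).1.2)
      exact hno k (Or.inr ⟨E, hE.mono (fun x hx => hx.1.1), hk, hU⟩)

theorem dj_list (hS : SigClass S) (hV : V ∉ S) {X : Set ℕ} (hX : X ∈ S) (hinf : X.Infinite)
    (Rs : List (Set ℕ)) :
    ∃ S', SigClass S' ∧ S ⊆ S' ∧ V ∉ S' ∧ ∃ Y ∈ S', Y.Infinite ∧ Y ⊆ X ∧
      ∀ R ∈ Rs, (Y ⊆ R ∨ Y ⊆ Rᶜ) := by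
  induction Rs with
  | nil => exact ⟨S, hS, subset_rfl, hV, X, hX, hinf, subset_rfl, by simp⟩
  | cons R Rs ih =>
    obtain ⟨S1, h1, h2, h3, Y, h4, h5, h6, h7⟩ := ih
    obtain ⟨S2, g1, g2, g3, Y', g4, g5, g6, g7⟩ := dj h1 h3 h4 h5 R
    refine ⟨S2, g1, h2.trans g2, g3, Y', g4, g5, g6.trans h6, ?_⟩
    intro R' hR'
    rcases List.mem_cons.1 hR' with rfl | hR'
    · exact g7
    · exact (h7 R' hR').imp g6.trans g6.trans

end DJ

/-! ### Relations of bounded degree and free sets -/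

/-- `M` has degree at most `r`. -/
def Deg (M : ℕ → ℕ → Prop) (r : ℕ) : Prop :=
  ∀ u L, Inc L → (∀ v ∈ L, M u v ∨ M v u) → L.length ≤ r

/-- No two distinct pairs of elements of `L` are related. -/
def PFree (M : ℕ → ℕ → Prop) (L : List ℕ) : Prop :=
  ∀ a ∈ L, ∀ b ∈ L, ∀ c ∈ L, ∀ d ∈ L, a < b → c < d → ¬ (a = c ∧ b = d) →
    ¬ M (Nat.pair a b) (Nat.pair c d)

/-- No two distinct diagonal pairs of elements of `L` are related. -/
def SFree (M : ℕ → ℕ → Prop) (L : List ℕ) : Prop :=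
  ∀ a ∈ L, ∀ b ∈ L, ¬ a = b → ¬ M (Nat.pair a a) (Nat.pair b b)

/-- Information about a relation contained in a finite binary string. -/
def Nt (σ : List Bool) (u v : ℕ) : Prop := σ[Nat.pair u v]? = some true

/-- Information about a relation contained in a finite binary string. -/
def Nf (σ : List Bool) (u v : ℕ) : Prop := ¬ σ[Nat.pair u v]? = some false

/-- The relation coded by `p`. -/
def Pr (p : ℕ → Bool) (u v : ℕ) : Prop := p (Nat.pair u v) = true

theorem Deg.mono {M N : ℕ → ℕ → Prop} (h : ∀ u v, M u v → N u v) {r : ℕ} (hN : Deg N r) :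
    Deg M r := fun u L hL hv => hN u L hL fun v hvL => (hv v hvL).imp (h _ _) (h _ _)

theorem PFree.mono {M N : ℕ → ℕ → Prop} (h : ∀ u v, M u v → N u v) {L : List ℕ}
    (hN : PFree N L) : PFree M L := fun a ha b hb c hc d hd h1 h2 h3 hM =>
  hN a ha b hb c hc d hd h1 h2 h3 (h _ _ hM)

theorem SFree.mono {M N : ℕ → ℕ → Prop} (h : ∀ u v, M u v → N u v) {L : List ℕ}
    (hN : SFree N L) : SFree M L := fun a ha b hb h1 hM => hN a ha b hb h1 (h _ _ hM)

theorem PFree.sub {M : ℕ → ℕ → Prop} {L L' : List ℕ} (h : ∀ a ∈ L, a ∈ L')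
    (hL : PFree M L') : PFree M L := fun a ha b hb c hc d hd =>
  hL a (h a ha) b (h b hb) c (h c hc) d (h d hd)

theorem Inc.filter {L : List ℕ} (h : Inc L) (f : ℕ → Bool) : Inc (L.filter f) :=
  List.Pairwise.sublist List.filter_sublist h

theorem Deg.or {M N : ℕ → ℕ → Prop} {r s : ℕ} (hM : Deg M r) (hN : Deg N s) :
    Deg (fun u v => M u v ∨ N u v) (r + s) := by
  classical
  intro u L hL h
  rw [List.length_eq_length_filter_add (fun v => decide (M u v ∨ M v u))]
  apply add_le_add
  · apply hM u _ (hL.filter _)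
    intro v hv
    simpa using (List.mem_filter.1 hv).2
  · apply hN u _ (hL.filter _)
    intro v hv
    have h1 := (List.mem_filter.1 hv)
    have h2 := h v h1.1
    have h3 : ¬ (M u v ∨ M v u) := by simpa using h1.2
    tauto

theorem Deg.finite {M : ℕ → ℕ → Prop} {r : ℕ} (h : Deg M r) (u : ℕ) :
    {v | M u v ∨ M v u}.Finite := by
  by_contra hc
  obtain ⟨t, ht, hcard⟩ := Set.Infinite.exists_subset_card_eq hc (r + 1)
  have := h u (t.sort (· ≤ ·)) (t.sortedLT_sort.pairwise) (fun v hv => ht (by simpa using hv))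
  rw [Finset.length_sort, hcard] at this
  omega

theorem pair_mono {a b c d : ℕ} (h : a ≤ c) (h' : b ≤ d) : Nat.pair a b ≤ Nat.pair c d := by
  have h1 : Nat.pair a b ≤ Nat.pair c b := by
    rcases h.eq_or_lt with rfl | h
    · exact le_rfl
    · exact (Nat.pair_lt_pair_left b h).le
  have h2 : Nat.pair c b ≤ Nat.pair c d := by
    rcases h'.eq_or_lt with rfl | h
    · exact le_rfl
    · exact (Nat.pair_lt_pair_right c h).le
  exact h1.trans h2

theorem nt_pr {p : ℕ → Bool} {k u v : ℕ} (h : Nt (pre p k) u v) : Pr p u v := pre_val h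

theorem pr_nt {p : ℕ → Bool} {k u v : ℕ} (hk : Nat.pair u v < k) (h : Pr p u v) :
    Nt (pre p k) u v := by
  unfold Nt Pr at *
  rw [pre_getElem?, if_pos hk, h]

theorem pr_nf {p : ℕ → Bool} {k u v : ℕ} (h : Pr p u v) : Nf (pre p k) u v := by
  intro h'
  have := pre_val h'
  unfold Pr at h
  rw [h] at this
  cases this

theorem nf_pr {p : ℕ → Bool} {k u v : ℕ} (hk : Nat.pair u v < k) (h : Nf (pre p k) u v) :
    Pr p u v := by
  unfold Nf Pr at *
  rw [pre_getElem?, if_pos hk] at h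
  simpa using h

theorem nf_lt {σ : List Bool} {u v : ℕ} (h : ¬ Nf σ u v) : Nat.pair u v < σ.length := by
  unfold Nf at h
  rw [not_not] at h
  exact (List.getElem?_eq_some_iff.1 h).1

/-- The question asked by the forcing construction. -/
def Qn (X : Set ℕ) (F : List ℕ) (r : ℕ) (U : ℕ → List ℕ → Prop) (n : ℕ) (σ : List Bool) : Prop :=
  ¬ Deg (Nt σ) r ∨ (∃ z, z ∈ X ∧ ¬ PFree (Nt σ) (F ++ [z])) ∨ ¬ SFree (Nt σ) F ∨
  ∃ E, IncIn X E ∧ U n (F ++ E) ∧ PFree (Nf σ) (F ++ E) ∧ SFree (Nf σ) (F ++ E)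

section SgQ

variable {S : Set (Set ℕ)} {α : Type*} [Primcodable α]

theorem sg_ndeg (hS : SigClass S) (r : ℕ) {f : α → List Bool} (hf : Primrec f) :
    Sg S (fun a => ¬ Deg (Nt (f a)) r) := by
  have : Sg S (fun a => ∃ u : ℕ, ∃ L : List ℕ, Inc L ∧ (∀ v ∈ L, Nt (f a) u v ∨ Nt (f a) v u) ∧
      r < L.length) := by
    apply Sg.ex hS
    apply Sg.ex hS
    apply Sg.and hS
    · exact (sg_inc hS).comp hS (by fun_prop)
    apply Sg.and hS
    · apply Sg.ballList hS _ (by fun_prop)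
      unfold Nt
      exact Sg.prim hS (by fun_prop)
    · exact Sg.prim hS (by fun_prop)
  refine this.of_eq fun a => ?_
  unfold Deg
  push Not
  rfl

theorem sg_npfree (hS : SigClass S) {f : α → List Bool} (hf : Primrec f) {g : α → List ℕ}
    (hg : Primrec g) : Sg S (fun a => ¬ PFree (Nt (f a)) (g a)) := by
  have : Sg S (fun q => ∃ a ∈ g q, ∃ b ∈ g q, ∃ c ∈ g q, ∃ d ∈ g q,
      (a < b ∧ c < d ∧ ¬ (a = c ∧ b = d)) ∧ Nt (f q) (Nat.pair a b) (Nat.pair c d)) := by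
    apply Sg.exList hS _ hg
    apply Sg.exList hS _ (by fun_prop)
    apply Sg.exList hS _ (by fun_prop)
    apply Sg.exList hS _ (by fun_prop)
    unfold Nt
    exact Sg.prim hS (by fun_prop)
  refine this.of_eq fun a => ?_
  unfold PFree
  simp only [not_forall, not_not, exists_prop, and_assoc]

theorem sg_nsfree (hS : SigClass S) {f : α → List Bool} (hf : Primrec f) {g : α → List ℕ}
    (hg : Primrec g) : Sg S (fun a => ¬ SFree (Nt (f a)) (g a)) := by
  have : Sg S (fun q => ∃ a ∈ g q, ∃ b ∈ g q,
      (¬ a = b) ∧ Nt (f q) (Nat.pair a a) (Nat.pair b b)) := by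
    apply Sg.exList hS _ hg
    apply Sg.exList hS _ (by fun_prop)
    unfold Nt
    exact Sg.prim hS (by fun_prop)
  refine this.of_eq fun a => ?_
  unfold SFree
  simp only [not_forall, not_not, exists_prop]

theorem sg_pfree (hS : SigClass S) {f : α → List Bool} (hf : Primrec f) {g : α → List ℕ}
    (hg : Primrec g) : Sg S (fun a => PFree (Nf (f a)) (g a)) := by
  unfold PFree
  apply Sg.ballList hS _ hg
  apply Sg.ballList hS _ (by fun_prop)
  apply Sg.ballList hS _ (by fun_prop)
  apply Sg.ballList hS _ (by fun_prop)
  unfold Nf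
  exact Sg.prim hS (by fun_prop)

theorem sg_sfree (hS : SigClass S) {f : α → List Bool} (hf : Primrec f) {g : α → List ℕ}
    (hg : Primrec g) : Sg S (fun a => SFree (Nf (f a)) (g a)) := by
  unfold SFree
  apply Sg.ballList hS _ hg
  apply Sg.ballList hS _ (by fun_prop)
  unfold Nf
  exact Sg.prim hS (by fun_prop)

theorem sg_qn (hS : SigClass S) {X : Set ℕ} (hX : X ∈ S) (F : List ℕ) (r : ℕ)
    {U : ℕ → List ℕ → Prop} (hU : Sg S (fun q : ℕ × List ℕ => U q.1 q.2)) :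
    Sg S (fun q : ℕ × List Bool => Qn X F r U q.1 q.2) := by
  unfold Qn
  apply Sg.or hS (sg_ndeg hS r (by fun_prop))
  apply Sg.or hS
  · apply Sg.ex hS
    exact Sg.and hS (sg_mem hS hX (by fun_prop)) (sg_npfree hS (by fun_prop) (by fun_prop))
  apply Sg.or hS (sg_nsfree hS (by fun_prop) (by fun_prop))
  apply Sg.ex hS
  apply Sg.and hS ((sg_incIn hS hX).comp hS (by fun_prop))
  apply Sg.and hS (hU.comp hS (f := fun q : (ℕ × List Bool) × List ℕ => (q.1.1, F ++ q.2))
    (by fun_prop))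
  exact Sg.and hS (sg_pfree hS (by fun_prop) (by fun_prop))
    (sg_sfree hS (by fun_prop) (by fun_prop))

end SgQ

/-- Failure of the question gives a relation. -/
theorem qn_fail {X : Set ℕ} {F : List ℕ} {r : ℕ} {U : ℕ → List ℕ → Prop} {n : ℕ}
    {p : ℕ → Bool} (h : ∀ k, ¬ Qn X F r U n (pre p k)) :
    Deg (Pr p) r ∧ (∀ z ∈ X, PFree (Pr p) (F ++ [z])) ∧ SFree (Pr p) F ∧
      ∀ E, IncIn X E → U n (F ++ E) → PFree (Pr p) (F ++ E) → SFree (Pr p) (F ++ E) → False := by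
  refine ⟨?_, ?_, ?_, ?_⟩
  · intro u L hL hv
    by_contra hc
    obtain ⟨b, hb⟩ := list_bound (u :: L)
    refine h (Nat.pair b b + 1) (Or.inl fun hD => hc (hD u L hL fun v hvL => ?_))
    have hu := hb u (by simp)
    have hv' := hb v (by simp [hvL])
    exact (hv v hvL).imp (pr_nt (Nat.lt_succ_of_le (pair_mono hu hv')))
      (pr_nt (Nat.lt_succ_of_le (pair_mono hv' hu)))
  · intro z hz a ha b hb c hc d hd h1 h2 h3 h4
    exact h (Nat.pair (Nat.pair a b) (Nat.pair c d) + 1) (Or.inr (Or.inl ⟨z, hz, fun hP =>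
      hP a ha b hb c hc d hd h1 h2 h3 (pr_nt (Nat.lt_succ_self _) h4)⟩))
  · intro a ha b hb h1 h4
    exact h (Nat.pair (Nat.pair a a) (Nat.pair b b) + 1) (Or.inr (Or.inr (Or.inl fun hP =>
      hP a ha b hb h1 (pr_nt (Nat.lt_succ_self _) h4))))
  · intro E hE hU hP hS
    obtain ⟨b, hb⟩ := list_bound (F ++ E)
    refine h (Nat.pair (Nat.pair b b) (Nat.pair b b) + 1) (Or.inr (Or.inr (Or.inr
      ⟨E, hE, hU, ?_, ?_⟩)))
    · intro a ha b' hb' c hc d hd h1 h2 h3 h4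
      refine hP a ha b' hb' c hc d hd h1 h2 h3 (nf_pr ?_ h4)
      exact Nat.lt_succ_of_le (pair_mono (pair_mono (hb _ ha) (hb _ hb'))
        (pair_mono (hb _ hc) (hb _ hd)))
    · intro a ha b' hb' h1 h4
      refine hS a ha b' hb' h1 (nf_pr ?_ h4)
      exact Nat.lt_succ_of_le (pair_mono (pair_mono (hb _ ha) (hb _ ha))
        (pair_mono (hb _ hb') (hb _ hb')))

/-- Forcing conditions for strong cone avoidance of rainbow sets for pairs. -/
structure RC (S : Set (Set ℕ)) (V X0 : Set ℕ) (M0 : ℕ → ℕ → Prop) where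
  C : Set (Set ℕ)
  sig : SigClass C
  sub : S ⊆ C
  nmem : V ∉ C
  F : List ℕ
  X : Set ℕ
  mem : X ∈ C
  inf : X.Infinite
  subX : X ⊆ X0
  inc : IncIn X0 F
  lt : ∀ a ∈ F, ∀ x ∈ X, a < x
  r : ℕ
  M : ℕ → ℕ → Prop
  subM : ∀ u v, M0 u v → M u v
  deg : Deg M r
  pfree : ∀ z ∈ X, PFree M (F ++ [z])
  sfree : SFree M F

/-- Extension of conditions. -/
def RC.le {S : Set (Set ℕ)} {V X0 : Set ℕ} {M0 : ℕ → ℕ → Prop} (c' c : RC S V X0 M0) : Prop :=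
  (∃ E, c'.F = c.F ++ E ∧ IncIn c.X E) ∧ c'.X ⊆ c.X ∧ ∀ u v, c.M u v → c'.M u v

/-- The limit relation. -/
def Lim (M : ℕ → ℕ → Prop) (Y : Set ℕ) (k u v : ℕ) : Prop :=
  (u.unpair.1 < u.unpair.2 ∧ v.unpair.1 < v.unpair.2 ∧ M u v) ∨
  (u.unpair.1 = u.unpair.2 ∧ v.unpair.1 = v.unpair.2 ∧
    (M u v ∨ (u.unpair.1 < k ∧ v.unpair.1 < k ∧
      ∀ z ∈ Y, M (Nat.pair u.unpair.1 z) (Nat.pair v.unpair.1 z))))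

theorem lim_deg {M : ℕ → ℕ → Prop} {r : ℕ} (hM : Deg M r) {Y : Set ℕ} (hY : Y.Nonempty) (k : ℕ) :
    Deg (Lim M Y k) (2 * r) := by
  classical
  obtain ⟨z, hz⟩ := hY
  rw [two_mul]
  refine Deg.mono (N := fun u v => M u v ∨ (u.unpair.1 = u.unpair.2 ∧ v.unpair.1 = v.unpair.2 ∧
    M (Nat.pair u.unpair.1 z) (Nat.pair v.unpair.1 z))) ?_ (hM.or ?_)
  · rintro u v (⟨-, -, h⟩ | ⟨h1, h2, h | ⟨-, -, h⟩⟩)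
    · exact Or.inl h
    · exact Or.inl h
    · exact Or.inr ⟨h1, h2, h z hz⟩
  · intro u L hL hv
    have hlen : (L.map fun v => Nat.pair v.unpair.1 z).length = L.length := by simp
    rw [← hlen]
    apply hM (Nat.pair u.unpair.1 z)
    · unfold Inc
      rw [List.pairwise_map]
      refine List.Pairwise.imp_of_mem ?_ hL
      intro v w hvL hwL hvw
      apply Nat.pair_lt_pair_left
      have h1 : v.unpair.1 = v.unpair.2 := by rcases hv v hvL with h | h <;> tauto
      have h2 : w.unpair.1 = w.unpair.2 := by rcases hv w hwL with h | h <;> tauto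
      by_contra hc
      push Not at hc
      have := pair_mono hc (h1 ▸ h2 ▸ hc : w.unpair.2 ≤ v.unpair.2)
      rw [Nat.pair_unpair, Nat.pair_unpair] at this
      omega
    · intro w hw
      obtain ⟨v, hvL, rfl⟩ := List.mem_map.1 hw
      rcases hv v hvL with h | h
      · exact Or.inl h.2.2
      · exact Or.inr h.2.2

section L5

variable {S : Set (Set ℕ)} {V X0 : Set ℕ} {M0 : ℕ → ℕ → Prop}

/-- The positive answer to the question. -/
theorem rc_pos (c : RC S V X0 M0) {U : ℕ → List ℕ → Prop} {n : ℕ}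
    (h : ∀ p : ℕ → Bool, ∃ k, Qn c.X c.F (2 * c.r) U n (pre p k)) :
    ∃ c', RC.le c' c ∧ U n c'.F := by
  classical
  obtain ⟨k, hk⟩ := compact_unif _ h
  obtain ⟨S', hS', hSS', hV', Y, hY, hYinf, hYX, hYR⟩ := dj_list c.sig c.nmem c.mem c.inf
    (((List.range k) ×ˢ (List.range k)).map
      fun q => {z | c.M (Nat.pair q.1 z) (Nat.pair q.2 z)})
  obtain ⟨z0, hz0⟩ := hYinf.nonempty
  let p : ℕ → Bool := fun w => decide (Lim c.M Y k w.unpair.1 w.unpair.2)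
  have hp : ∀ u v, Pr p u v ↔ Lim c.M Y k u v := by
    intro u v
    simp [Pr, p]
  have hstrict : ∀ a b d e, a < b → d < e → (Lim c.M Y k (Nat.pair a b) (Nat.pair d e) ↔
      c.M (Nat.pair a b) (Nat.pair d e)) := by
    intro a b d e h1 h2
    simp only [Lim, Nat.unpair_pair]
    constructor
    · rintro (h | h)
      · exact h.2.2
      · omega
    · intro h
      exact Or.inl ⟨h1, h2, h⟩
  have hdiag : ∀ a b, (Lim c.M Y k (Nat.pair a a) (Nat.pair b b) ↔
      (c.M (Nat.pair a a) (Nat.pair b b) ∨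
        (a < k ∧ b < k ∧ ∀ z ∈ Y, c.M (Nat.pair a z) (Nat.pair b z)))) := by
    intro a b
    simp only [Lim, Nat.unpair_pair, lt_self_iff_false, false_and, false_or, true_and]
  obtain ⟨j, hj, hq⟩ := hk p
  have hmemL : ∀ {a : ℕ} {z : ℕ}, a ∈ c.F → a ∈ c.F ++ [z] := fun h => List.mem_append_left _ h
  rcases hq with hA | ⟨z, hz, hB⟩ | hC | ⟨E, hE, hU, hPF, hSF⟩
  · exact absurd ((lim_deg c.deg hYinf.nonempty k).mono fun u v h => (hp u v).1 (nt_pr h)) hA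
  · refine absurd ?_ hB
    intro a ha b hb d hd e he h1 h2 h3 h4
    exact c.pfree z hz a ha b hb d hd e he h1 h2 h3
      ((hstrict a b d e h1 h2).1 ((hp _ _).1 (nt_pr h4)))
  · refine absurd ?_ hC
    intro a ha b hb h1 h2
    rcases (hdiag a b).1 ((hp _ _).1 (nt_pr h2)) with h | ⟨-, -, h⟩
    · exact c.sfree a ha b hb h1 h
    · have hz := hYX hz0
      exact c.pfree z0 hz a (hmemL ha) z0 (by simp) b (hmemL hb) z0 (by simp)
        (c.lt a ha _ hz) (c.lt b hb _ hz) (fun h => h1 h.1) (h z0 hz0)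
  · have hPM : PFree c.M (c.F ++ E) := by
      intro a ha b hb d hd e he h1 h2 h3 h4
      exact hPF a ha b hb d hd e he h1 h2 h3
        (pr_nf ((hp _ _).2 ((hstrict a b d e h1 h2).2 h4)))
    have hSM : SFree c.M (c.F ++ E) := by
      intro a ha b hb h1 h2
      exact hSF a ha b hb h1 (pr_nf ((hp _ _).2 ((hdiag a b).2 (Or.inl h2))))
    have hR : ∀ a ∈ c.F ++ E, ∀ b ∈ c.F ++ E, ¬ a = b → ∀ z ∈ Y,
        ¬ c.M (Nat.pair a z) (Nat.pair b z) := by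
      intro a ha b hb h1 z hz h2
      have hlt := nf_lt (hSF a ha b hb h1)
      rw [pre_length] at hlt
      have hak : a < k := by
        have := Nat.left_le_pair a a
        have := Nat.left_le_pair (Nat.pair a a) (Nat.pair b b)
        omega
      have hbk : b < k := by
        have := Nat.left_le_pair b b
        have := Nat.right_le_pair (Nat.pair a a) (Nat.pair b b)
        omega
      rcases hYR {z | c.M (Nat.pair a z) (Nat.pair b z)} (List.mem_map.2
        ⟨(a, b), by simp [hak, hbk], rfl⟩) with h | h
      · exact hSF a ha b hb h1 (pr_nf ((hp _ _).2 ((hdiag a b).2 (Or.inr ⟨hak, hbk, h⟩))))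
      · exact h hz h2
    have hfin : {z | ∃ a ∈ c.F ++ E, ∃ d ∈ c.F ++ E, ∃ e ∈ c.F ++ E,
        c.M (Nat.pair d e) (Nat.pair a z) ∨ c.M (Nat.pair a z) (Nat.pair d e)}.Finite := by
      have : ∀ a d e, {z | c.M (Nat.pair d e) (Nat.pair a z) ∨
          c.M (Nat.pair a z) (Nat.pair d e)}.Finite := by
        intro a d e
        refine Set.Finite.preimage (f := fun z => Nat.pair a z) ?_ (c.deg.finite (Nat.pair d e))
        intro x _ y _ hxy
        exact (Nat.pair_eq_pair.1 hxy).2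
      have h2 : {z | ∃ a ∈ c.F ++ E, ∃ d ∈ c.F ++ E, ∃ e ∈ c.F ++ E,
          c.M (Nat.pair d e) (Nat.pair a z) ∨ c.M (Nat.pair a z) (Nat.pair d e)} =
          ⋃ a ∈ {x | x ∈ c.F ++ E}, ⋃ d ∈ {x | x ∈ c.F ++ E}, ⋃ e ∈ {x | x ∈ c.F ++ E},
          {z | c.M (Nat.pair d e) (Nat.pair a z) ∨ c.M (Nat.pair a z) (Nat.pair d e)} := by
        ext z
        simp only [Set.mem_iUnion, Set.mem_ofPred_eq, exists_prop]
      rw [h2]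
      have hl : {x | x ∈ c.F ++ E}.Finite := List.finite_toSet _
      exact hl.biUnion fun a _ => hl.biUnion fun d _ => hl.biUnion fun e _ => this a d e
    obtain ⟨b1, hb1⟩ := hfin.bddAbove
    obtain ⟨b2, hb2⟩ := list_bound (c.F ++ E)
    have hlt : ∀ a ∈ c.F ++ E, ∀ x ∈ {z ∈ Y | max b1 b2 < z}, a < x := by
      intro a ha x hx
      exact (hb2 a ha).trans_lt ((le_max_right _ _).trans_lt hx.2)
    have hbad : ∀ a ∈ c.F ++ E, ∀ d ∈ c.F ++ E, ∀ e ∈ c.F ++ E,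
        ∀ x ∈ {z ∈ Y | max b1 b2 < z},
        ¬ (c.M (Nat.pair d e) (Nat.pair a x) ∨ c.M (Nat.pair a x) (Nat.pair d e)) := by
      intro a ha d hd e he x hx h
      have h1 : x ≤ b1 := hb1 ⟨a, ha, d, hd, e, he, h⟩
      have h2 : max b1 b2 < x := hx.2
      have := le_max_left b1 b2
      omega
    refine ⟨⟨S', hS', c.sub.trans hSS', hV', c.F ++ E, {z ∈ Y | max b1 b2 < z},
      mem_above hS' hY _, inf_above hYinf _, fun z hz => c.subX (hYX hz.1),
      ⟨inc_append c.inc.1 c.lt hE, ?_⟩, hlt, c.r, c.M, c.subM, c.deg, ?_, hSM⟩,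
      ⟨⟨E, rfl, hE⟩, fun z hz => hYX hz.1, fun _ _ h => h⟩, hU⟩
    · intro e he
      rcases List.mem_append.1 he with he | he
      · exact c.inc.2 e he
      · exact c.subX (hE.2 e he)
    · intro z hz a ha b hb d hd e he h1 h2 h3 h4
      have hle : ∀ x ∈ (c.F ++ E) ++ [z], x ∈ c.F ++ E ∨ x = z := by
        intro x hx
        rcases List.mem_append.1 hx with h | h
        · exact Or.inl h
        · exact Or.inr (List.mem_singleton.1 h)
      have ha' : a ∈ c.F ++ E := by
        rcases hle a ha with h | rfl
        · exact h
        · rcases hle b hb with h | rfl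
          · have := hlt b h _ hz
            omega
          · omega
      have hd' : d ∈ c.F ++ E := by
        rcases hle d hd with h | rfl
        · exact h
        · rcases hle e he with h | rfl
          · have := hlt e h _ hz
            omega
          · omega
      rcases hle b hb with hb' | rfl
      · rcases hle e he with he' | rfl
        · exact hPM a ha' b hb' d hd' e he' h1 h2 h3 h4
        · exact hbad d hd' a ha' b hb' _ hz (Or.inl h4)
      · rcases hle e he with he' | rfl
        · exact hbad a ha' d hd' e he' _ hz (Or.inr h4)
        · exact hR a ha' d hd' (fun h => h3 ⟨h, rfl⟩) _ hz.1 h4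

theorem RC.le_refl (c : RC S V X0 M0) : RC.le c c :=
  ⟨⟨[], by simp, incIn_nil⟩, subset_rfl, fun _ _ h => h⟩

theorem RC.le_trans (a b c : RC S V X0 M0) (hab : RC.le a b) (hbc : RC.le b c) : RC.le a c := by
  obtain ⟨⟨E1, h1, h1'⟩, h2, h5⟩ := hab
  obtain ⟨⟨E2, h3, h3'⟩, h4, h6⟩ := hbc
  refine ⟨⟨E2 ++ E1, by rw [h1, h3, List.append_assoc], ?_, ?_⟩, h2.trans h4,
    fun u v h => h5 u v (h6 u v h)⟩
  · have := a.inc.1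
    rw [h1, h3, List.append_assoc] at this
    exact (List.pairwise_append.1 this).2.1
  · intro e he
    rcases List.mem_append.1 he with he | he
    · exact h3'.2 e he
    · exact h4 (h1'.2 e he)

theorem RC.pfreeF (c : RC S V X0 M0) : PFree c.M c.F := by
  obtain ⟨z, hz⟩ := c.inf.nonempty
  exact (c.pfree z hz).sub fun a ha => List.mem_append_left _ ha

theorem rc_len (c : RC S V X0 M0) : ∃ c', RC.le c' c ∧ c.F.length < c'.F.length := by
  have := rc_pos c (U := fun _ L => c.F.length < L.length) (n := 0) (by
    intro p
    by_contra hcon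
    push Not at hcon
    obtain ⟨h1, h2, h3, h4⟩ := qn_fail hcon
    have hfin : (⋃ a ∈ {x | x ∈ c.F}, {z | Pr p (Nat.pair a a) (Nat.pair z z) ∨
        Pr p (Nat.pair z z) (Nat.pair a a)}).Finite := by
      refine Set.Finite.biUnion (List.finite_toSet c.F) fun a _ => ?_
      refine Set.Finite.preimage (f := fun z => Nat.pair z z) ?_ (h1.finite (Nat.pair a a))
      intro x _ y _ hxy
      exact (Nat.pair_eq_pair.1 hxy).2
    obtain ⟨x, hx, hxn⟩ := (c.inf.sdiff hfin).nonempty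
    simp only [Set.mem_iUnion, Set.mem_ofPred_eq, exists_prop, not_exists, not_and, not_or] at hxn
    refine h4 [x] (incIn_single hx) (by simp) (h2 x hx) ?_
    intro a ha b hb hab
    rcases List.mem_append.1 ha with ha | ha
    · rcases List.mem_append.1 hb with hb | hb
      · exact h3 a ha b hb hab
      · rw [List.mem_singleton.1 hb]
        exact (hxn a ha).1
    · rw [List.mem_singleton.1 ha] at hab ⊢
      rcases List.mem_append.1 hb with hb | hb
      · exact (hxn b hb).2
      · exact absurd (List.mem_singleton.1 hb).symm hab)
  exact this

theorem rc_dec (U : ℕ → List ℕ → Prop) (hU : Sg S (fun q : ℕ × List ℕ => U q.1 q.2))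
    (c : RC S V X0 M0) : ∃ c', RC.le c' c ∧
      ((∃ n, n ∉ V ∧ U n c'.F) ∨ ∃ n, n ∈ V ∧ ∀ c'', RC.le c'' c' → ¬ U n c''.F) := by
  have h := sg_compact c.sig (sg_qn c.sig c.mem c.F (2 * c.r) (hU.mono c.sub))
  rw [sg_nat] at h
  rcases ne_cases h c.nmem with ⟨n, hn, hn'⟩ | ⟨n, hn, hn'⟩
  · obtain ⟨c', h1, h2⟩ := rc_pos c hn
    exact ⟨c', h1, Or.inl ⟨n, hn', h2⟩⟩
  · have hn2 : ¬ ∀ p : ℕ → Bool, ∃ k, Qn c.X c.F (2 * c.r) U n (pre p k) := hn'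
    push Not at hn2
    obtain ⟨p, hp⟩ := hn2
    obtain ⟨h1, h2, h3, h4⟩ := qn_fail hp
    refine ⟨⟨c.C, c.sig, c.sub, c.nmem, c.F, c.X, c.mem, c.inf, c.subX, c.inc, c.lt,
      c.r + 2 * c.r, fun u v => c.M u v ∨ Pr p u v, fun u v h => Or.inl (c.subM u v h),
      c.deg.or h1, ?_, ?_⟩, ⟨⟨[], by simp, incIn_nil⟩, subset_rfl, fun _ _ h => Or.inl h⟩,
      Or.inr ⟨n, hn, ?_⟩⟩
    · intro z hz a ha b hb d hd e he g1 g2 g3 g4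
      rcases g4 with g4 | g4
      · exact c.pfree z hz a ha b hb d hd e he g1 g2 g3 g4
      · exact h2 z hz a ha b hb d hd e he g1 g2 g3 g4
    · intro a ha b hb g1 g4
      rcases g4 with g4 | g4
      · exact c.sfree a ha b hb g1 g4
      · exact h3 a ha b hb g1 g4
    · rintro c'' ⟨⟨E, h5, hE⟩, -, hM⟩ hU''
      have hP : PFree (Pr p) c''.F := c''.pfreeF.mono fun u v h => hM u v (Or.inr h)
      have hS : SFree (Pr p) c''.F := c''.sfree.mono fun u v h => hM u v (Or.inr h)
      rw [h5] at hP hS hU''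
      exact h4 E hE hU'' hP hS

/-- Strong cone avoidance for rainbows of pairs. -/
theorem strong_pairs (hS : SigClass S) (hV : V ∉ S) (hX : X0 ∈ S) (hinf : X0.Infinite)
    {r : ℕ} (hM : Deg M0 r) :
    ∃ S', SigClass S' ∧ S ⊆ S' ∧ V ∉ S' ∧ ∃ Y ∈ S', Y.Infinite ∧ Y ⊆ X0 ∧
      ∀ a ∈ Y, ∀ b ∈ Y, ∀ c ∈ Y, ∀ d ∈ Y, a < b → c < d → ¬ (a = c ∧ b = d) →
        ¬ M0 (Nat.pair a b) (Nat.pair c d) := by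
  -- the relation is first restricted to increasing pairs
  have hM' : Deg (fun u v => M0 u v ∧ u.unpair.1 < u.unpair.2 ∧ v.unpair.1 < v.unpair.2 ∧ u ≠ v) r :=
    hM.mono fun u v h => h.1
  obtain ⟨G, hG, c, -, hmono, hpre, hl, -⟩ := generic hS (V := V)
    (C := RC S V X0 (fun u v => M0 u v ∧ u.unpair.1 < u.unpair.2 ∧ v.unpair.1 < v.unpair.2 ∧ u ≠ v))
    RC.le RC.le_refl RC.le_trans (fun c => c.F)
    (by rintro c c' ⟨⟨E, h, -⟩, -⟩; rw [h]; exact List.prefix_append _ _)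
    ⟨S, hS, subset_rfl, hV, [], X0, hX, hinf, subset_rfl, incIn_nil, by simp, r, _,
      fun _ _ h => h, hM', by
        intro z _ a ha b hb d hd e he h1
        simp only [List.nil_append, List.mem_singleton] at ha hb
        omega, by intro a ha; simp at ha⟩
    rc_len rc_dec (ι := Empty) (fun _ _ => True) (fun i => i.elim)
  obtain ⟨hGm, hGl⟩ := range_facts (fun i => (c i).inc.1) hpre hl
  have hpF : ∀ i j, i ≤ j → ∀ x ∈ (c i).F, x ∈ (c j).F := by
    intro i j hij x hx
    obtain ⟨⟨E, h, -⟩, -⟩ := hmono i j hij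
    rw [h]
    exact List.mem_append_left _ hx
  refine ⟨Ext S G, ext_sig hS, sub_ext hS, hG, Set.range G, range_mem_ext hS,
    Set.infinite_range_of_injective hGm.injective, ?_, ?_⟩
  · rintro _ ⟨k, rfl⟩
    obtain ⟨i, hi⟩ := hGl k
    exact (c i).inc.2 _ hi
  · rintro _ ⟨a, rfl⟩ _ ⟨b, rfl⟩ _ ⟨d, rfl⟩ _ ⟨e, rfl⟩ h1 h2 h3 h4
    obtain ⟨ia, ha⟩ := hGl a
    obtain ⟨ib, hb⟩ := hGl b
    obtain ⟨id, hd⟩ := hGl d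
    obtain ⟨ie, he⟩ := hGl e
    have key := (c (ia + ib + id + ie)).pfreeF
    refine key _ (hpF _ _ (by omega) _ ha) _ (hpF _ _ (by omega) _ hb) _
      (hpF _ _ (by omega) _ hd) _ (hpF _ _ (by omega) _ he) h1 h2 h3
      ((c (ia + ib + id + ie)).subM _ _ ⟨h4, by simpa using h1, by simpa using h2, ?_⟩)
    intro h
    exact h3 (Nat.pair_eq_pair.1 h)

end L5

/-! ### Recursion relative to an oracle -/

section Tot

variable {O : ℕ →. ℕ}

/-- Total functions recursive in `O`. -/
def Tot (O : ℕ →. ℕ) (h : ℕ → ℕ) : Prop := RecursiveIn O (h : ℕ →. ℕ)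

theorem rec_congr {φ ψ : ℕ →. ℕ} (h : RecursiveIn O φ) (e : ∀ n, ψ n = φ n) :
    RecursiveIn O ψ := by
  have : ψ = φ := funext e
  rwa [this]

theorem Tot.of_eq {f g : ℕ → ℕ} (hf : Tot O f) (h : ∀ n, f n = g n) : Tot O g := by
  have : f = g := funext h
  rwa [← this]

theorem Tot.comp {f g : ℕ → ℕ} (hf : Tot O f) (hg : Tot O g) : Tot O (fun n => f (g n)) := by
  have := RecursiveIn.comp hf hg
  refine rec_congr this fun n => ?_
  exact (Part.bind_some (g n) (f : ℕ →. ℕ)).symm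

theorem Tot.pair {f g : ℕ → ℕ} (hf : Tot O f) (hg : Tot O g) :
    Tot O (fun n => Nat.pair (f n) (g n)) := by
  have := RecursiveIn.pair hf hg
  refine rec_congr this fun n => ?_
  simp [Seq.seq]

theorem Tot.prec {f g : ℕ → ℕ} (hf : Tot O f) (hg : Tot O g) :
    Tot O (fun w => Nat.rec (f w.unpair.1)
      (fun y IH => g (Nat.pair w.unpair.1 (Nat.pair y IH))) w.unpair.2) := by
  have := RecursiveIn.prec hf hg
  refine rec_congr this fun w => ?_
  simp only [Nat.unpaired, PFun.coe_val]
  induction w.unpair.2 with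
  | zero => simp
  | succ n ih =>
    simp only [] at ih ⊢
    rw [← ih]
    simp

theorem Tot.natPrim {h : ℕ → ℕ} (hh : Nat.Primrec h) : Tot O h := by
  induction hh with
  | zero => exact RecursiveIn.zero
  | succ => exact RecursiveIn.succ
  | left => exact RecursiveIn.left
  | right => exact RecursiveIn.right
  | pair _ _ hf hg => exact hf.pair hg
  | comp _ _ hf hg => exact hf.comp hg
  | prec _ _ hf hg => exact (hf.prec hg).of_eq fun n => rfl

theorem Tot.prim {h : ℕ → ℕ} (hh : Primrec h) : Tot O h := Tot.natPrim (Primrec.nat_iff.1 hh)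

theorem Tot.prim2 {g : ℕ → ℕ → ℕ} (hg : Primrec (fun q : ℕ × ℕ => g q.1 q.2)) {f1 f2 : ℕ → ℕ}
    (h1 : Tot O f1) (h2 : Tot O f2) : Tot O (fun n => g (f1 n) (f2 n)) := by
  have h : Primrec (fun w : ℕ => g w.unpair.1 w.unpair.2) :=
    hg.comp (g := fun w : ℕ => (w.unpair.1, w.unpair.2)) (by fun_prop)
  exact ((Tot.prim h).comp (h1.pair h2)).of_eq fun n => by simp

theorem Tot.cp {h g : ℕ → ℕ} (hh : Tot O h) (hg : Primrec g) : Tot O (fun n => h (g n)) :=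
  hh.comp (Tot.prim hg)

end Tot

/-- Evaluation of codes with an oracle. -/
noncomputable def ev (O : ℕ →. ℕ) : Nat.Partrec.Code → (ℕ →. ℕ)
  | .zero => O
  | .succ => ((Nat.succ : ℕ → ℕ) : ℕ →. ℕ)
  | .left => ((fun n : ℕ => n.unpair.1 : ℕ → ℕ) : ℕ →. ℕ)
  | .right => ((fun n : ℕ => n.unpair.2 : ℕ → ℕ) : ℕ →. ℕ)
  | .pair f g => fun n => Nat.pair <$> ev O f n <*> ev O g n
  | .comp f g => fun n => ev O g n >>= ev O f
  | .prec f g => Nat.unpaired fun a n =>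
        n.rec (ev O f a) fun y IH => do let i ← IH; ev O g (Nat.pair a (Nat.pair y i))
  | .rfind' f => fun a => Nat.rfind fun n => (fun m => m = 0) <$> ev O f (Nat.pair a n)

theorem countable_rec (O : ℕ →. ℕ) : {φ | RecursiveIn O φ}.Countable := by
  refine (Set.countable_range (ev O)).mono ?_
  suffices H : ∀ φ, RecursiveIn O φ → φ ∈ Set.range (ev O) from fun φ hφ => H φ hφ
  intro φ hφ
  induction hφ with
  | zero =>
    refine ⟨.rfind' .right, ?_⟩
    funext a
    refine Part.eq_some_iff.2 ?_
    refine Nat.mem_rfind.2 ⟨?_, ?_⟩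
    · simp [ev]
    · simp
  | succ => exact ⟨.succ, rfl⟩
  | left => exact ⟨.left, rfl⟩
  | right => exact ⟨.right, rfl⟩
  | oracle => exact ⟨.zero, rfl⟩
  | pair _ _ hf hg =>
    obtain ⟨a, rfl⟩ := hf
    obtain ⟨b, rfl⟩ := hg
    exact ⟨.pair a b, rfl⟩
  | comp _ _ hf hg =>
    obtain ⟨a, rfl⟩ := hf
    obtain ⟨b, rfl⟩ := hg
    exact ⟨.comp a b, rfl⟩
  | prec _ _ hf hg =>
    obtain ⟨a, rfl⟩ := hf
    obtain ⟨b, rfl⟩ := hg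
    exact ⟨.prec a b, rfl⟩
  | rfind _ hf =>
    obtain ⟨a, rfl⟩ := hf
    exact ⟨.rfind' a, rfl⟩

/-- The sets recursively enumerable in `O`. -/
def RE (O : ℕ →. ℕ) : Set (Set ℕ) :=
  {A | ∃ h : ℕ → ℕ, Tot O h ∧ ∀ n, n ∈ A ↔ ∃ m, h (Nat.pair n m) = 0}

theorem countable_re (O : ℕ →. ℕ) : (RE O).Countable := by
  classical
  have h1 : {h : ℕ → ℕ | Tot O h}.Countable := by
    refine Set.Countable.preimage_of_injOn (f := fun h : ℕ → ℕ => (h : ℕ →. ℕ))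
      (countable_rec O) ?_
    intro f _ g _ hfg
    funext n
    have := congrFun hfg n
    simpa using this
  refine (h1.image fun h => {n | ∃ m, h (Nat.pair n m) = 0}).mono ?_
  rintro A ⟨h, hh, hA⟩
  exact ⟨h, hh, Set.ext fun n => (hA n).symm⟩

theorem pr_getList : Primrec (fun q : ℕ × ℕ =>
    (((Encodable.decode q.1 : Option (List ℕ)).getD [])[q.2]?).getD 0) := by
  refine Primrec.option_getD.comp (Primrec.list_getElem?.comp
    (Primrec.option_getD.comp (Primrec.decode.comp Primrec.fst) (Primrec.const _)) Primrec.snd)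
    (Primrec.const _)

theorem re_sig (O : ℕ →. ℕ) : SigClass (RE O) where
  cnt := countable_re O
  prim p hp := by
    classical
    refine ⟨fun w => if p w.unpair.1 then 0 else 1, Tot.prim ?_, fun n => by simp⟩
    have : PrimrecPred (fun w : ℕ => p w.unpair.1) :=
      hp.comp (f := fun w : ℕ => w.unpair.1) (by fun_prop)
    exact Primrec.ite this (Primrec.const 0) (Primrec.const 1)
  inter := by
    rintro A ⟨h1, hh1, hA⟩ B ⟨h2, hh2, hB⟩
    refine ⟨fun w => h1 (Nat.pair w.unpair.1 w.unpair.2.unpair.1) +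
      h2 (Nat.pair w.unpair.1 w.unpair.2.unpair.2), ?_, fun n => ?_⟩
    · exact Tot.prim2 (g := fun a b => a + b) (by fun_prop) (hh1.cp (by fun_prop))
        (hh2.cp (by fun_prop))
    · simp only [Set.mem_inter_iff, hA, hB, Nat.unpair_pair, Nat.add_eq_zero_iff]
      constructor
      · rintro ⟨⟨a, ha⟩, b, hb⟩
        exact ⟨Nat.pair a b, by simpa using ⟨ha, hb⟩⟩
      · rintro ⟨m, ha, hb⟩
        exact ⟨⟨_, ha⟩, _, hb⟩
  union := by
    rintro A ⟨h1, hh1, hA⟩ B ⟨h2, hh2, hB⟩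
    refine ⟨fun w => h1 w * h2 w, Tot.prim2 (g := fun a b => a * b) (by fun_prop) hh1 hh2,
      fun n => ?_⟩
    simp only [Set.mem_union, hA, hB, mul_eq_zero, exists_or]
  proj := by
    rintro A ⟨h1, hh1, hA⟩
    refine ⟨fun w => h1 (Nat.pair (Nat.pair w.unpair.1 w.unpair.2.unpair.1) w.unpair.2.unpair.2),
      hh1.cp (by fun_prop), fun n => ?_⟩
    simp only [Set.mem_ofPred_eq, hA, Nat.unpair_pair]
    constructor
    · rintro ⟨a, b, h⟩
      exact ⟨Nat.pair a b, by simpa using h⟩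
    · rintro ⟨m, h⟩
      exact ⟨_, _, h⟩
  comap := by
    rintro g hg A ⟨h1, hh1, hA⟩
    refine ⟨fun w => h1 (Nat.pair (g w.unpair.1) w.unpair.2), hh1.cp (by fun_prop), fun n => ?_⟩
    simp only [Set.mem_preimage, hA, Nat.unpair_pair]
  ball := by
    rintro A ⟨h1, hh1, hA⟩
    let gl : ℕ → ℕ → ℕ := fun s m =>
      (((Encodable.decode s : Option (List ℕ)).getD [])[m]?).getD 0
    have hgl : Primrec (fun q : ℕ × ℕ => gl q.1 q.2) := pr_getList
    have hp1 : Tot O (fun w => w.unpair.2.unpair.2 + h1 (Nat.pair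
        (Nat.pair w.unpair.1.unpair.1.unpair.1 w.unpair.2.unpair.1)
        (gl w.unpair.1.unpair.2 w.unpair.2.unpair.1))) := by
      refine Tot.prim2 (g := fun a b => a + b) (by fun_prop) (Tot.prim (by fun_prop)) (hh1.cp ?_)
      refine pr_natPair (by fun_prop) ?_
      exact hgl.comp (g := fun w : ℕ => (w.unpair.1.unpair.2, w.unpair.2.unpair.1)) (by fun_prop)
    have hp2 := (Tot.prec (Tot.prim (Primrec.const 0)) hp1).cp
      (g := fun w : ℕ => Nat.pair w w.unpair.1.unpair.2) (by fun_prop)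
    refine ⟨_, hp2, fun n => ?_⟩
    simp only [Nat.unpair_pair, Set.mem_ofPred_eq, hA]
    have key : ∀ (s b : ℕ), (Nat.rec 0 (fun y IH => IH + h1 (Nat.pair
        (Nat.pair n.unpair.1 y) (gl s y))) b : ℕ) = 0 ↔
        ∀ y < b, h1 (Nat.pair (Nat.pair n.unpair.1 y) (gl s y)) = 0 := by
      intro s b
      induction b with
      | zero => simp
      | succ b ih =>
        simp only [] at ih ⊢
        rw [Nat.add_eq_zero_iff, ih]
        constructor
        · rintro ⟨h1, h2⟩ y hy
          rcases Nat.lt_succ_iff_lt_or_eq.1 hy with h | rfl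
          · exact h1 y h
          · exact h2
        · intro h
          exact ⟨fun y hy => h y (by omega), h b (by omega)⟩
    simp only [key]
    constructor
    · intro h
      choose! s hs using h
      refine ⟨Encodable.encode ((List.range n.unpair.2).map s), fun y hy => ?_⟩
      have : gl (Encodable.encode ((List.range n.unpair.2).map s)) y = s y := by
        simp [gl, hy]
      rw [this]
      exact hs y hy
    · rintro ⟨s, hs⟩ y hy
      exact ⟨_, hs y hy⟩

/-- The graph of the characteristic function. -/
def Gr (W : Set ℕ) : Set ℕ := {w | chi W w.unpair.1 = w.unpair.2}

theorem sg_gr {S : Set (Set ℕ)} (hS : SigClass S) {f : ℕ → ℕ} :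
    Sg S (fun q : ℕ × ℕ => f q.1 = q.2) ↔ {w : ℕ | f w.unpair.1 = w.unpair.2} ∈ S := by
  constructor
  · intro h
    exact sg_nat.1 (h.comp hS (f := fun w : ℕ => (w.unpair.1, w.unpair.2)) (by fun_prop))
  · intro h
    have := (sg_nat.2 h).comp hS (f := fun q : ℕ × ℕ => Nat.pair q.1 q.2) (by fun_prop)
    exact this.of_eq fun q => by simp

theorem graph_re {O : ℕ →. ℕ} {f : ℕ → ℕ} (hf : Tot O f) :
    Sg (RE O) (fun q : ℕ × ℕ => f q.1 = q.2) := by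
  rw [sg_gr (re_sig O)]
  refine ⟨fun w => (f w.unpair.1.unpair.1 - w.unpair.1.unpair.2) +
    (w.unpair.1.unpair.2 - f w.unpair.1.unpair.1), ?_, fun n => ?_⟩
  · exact Tot.prim2 (g := fun a b => (a - b) + (b - a)) (by fun_prop) (hf.cp (by fun_prop))
      (Tot.prim (by fun_prop))
  · simp only [Set.mem_ofPred_eq, Nat.unpair_pair, exists_const]
    omega

theorem turing_of_gr {W Z : Set ℕ} (h : Gr W ∈ RE (chi Z)) : TuringLE W Z := by
  obtain ⟨h, hh, hW⟩ := h
  have h1 : Tot (chi Z) (fun w => h (Nat.pair (Nat.pair w.unpair.1 w.unpair.2.unpair.1)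
    w.unpair.2.unpair.2)) := hh.cp (by fun_prop)
  have h2 := RecursiveIn.comp RecursiveIn.left (RecursiveIn.rfind h1)
  refine rec_congr h2 fun x => ?_
  symm
  obtain ⟨m, hm⟩ := (hW (Nat.pair x (chi W x))).1 (by simp [Gr])
  have hex : ∃ t : ℕ, h (Nat.pair (Nat.pair x t.unpair.1) t.unpair.2) = 0 :=
    ⟨Nat.pair (chi W x) m, by simpa using hm⟩
  rw [PFun.coe_val, Part.eq_some_iff]
  refine Part.mem_bind_iff.2 ⟨Nat.find hex, ?_, ?_⟩
  · refine Nat.mem_rfind.2 ⟨?_, ?_⟩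
    · have := Nat.find_spec hex
      simpa using this
    · intro m hm
      have := Nat.find_min hex hm
      simpa using this
  · have h3 := (hW (Nat.pair x (Nat.find hex).unpair.1)).2 ⟨_, Nat.find_spec hex⟩
    simp [Gr] at h3
    simp [h3]

theorem rec_mem_iff {f g : ℕ →. ℕ} (a n v : ℕ) :
    v ∈ (Nat.rec (f a) (fun y IH => IH >>= fun i => g (Nat.pair a (Nat.pair y i))) n : Part ℕ) ↔
    ∃ L : List ℕ, (∃ v0, L[0]? = some v0 ∧ v0 ∈ f a) ∧
      (∀ y < n, ∃ i j, L[y]? = some i ∧ L[y + 1]? = some j ∧ j ∈ g (Nat.pair a (Nat.pair y i))) ∧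
      L[n]? = some v := by
  constructor
  · intro h
    suffices H : ∃ L : List ℕ, L.length = n + 1 ∧ (∃ v0, L[0]? = some v0 ∧ v0 ∈ f a) ∧
      (∀ y < n, ∃ i j, L[y]? = some i ∧ L[y + 1]? = some j ∧ j ∈ g (Nat.pair a (Nat.pair y i))) ∧
      L[n]? = some v by
      obtain ⟨L, -, h⟩ := H
      exact ⟨L, h⟩
    induction n generalizing v with
    | zero => exact ⟨[v], by simp, ⟨v, by simp, h⟩, by simp, by simp⟩
    | succ n ih =>
      obtain ⟨i, hi, hv⟩ := Part.mem_bind_iff.1 h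
      obtain ⟨L, hlen, ⟨v0, h1, h2⟩, h3, h4⟩ := ih i hi
      have hap : ∀ k, k < n + 1 → (L ++ [v])[k]? = L[k]? := fun k hk =>
        List.getElem?_append_left (by omega)
      have hlast : (L ++ [v])[n + 1]? = some v := by
        rw [← hlen]; simp
      refine ⟨L ++ [v], by simp [hlen], ⟨v0, by rw [hap 0 (by omega), h1], h2⟩, ?_, hlast⟩
      intro y hy
      rcases Nat.lt_succ_iff_lt_or_eq.1 hy with hy | rfl
      · rw [hap y (by omega), hap (y + 1) (by omega)]
        exact h3 y hy
      · exact ⟨i, v, by rw [hap y (by omega), h4], hlast, hv⟩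
  · rintro ⟨L, ⟨v0, h1, h2⟩, h3, h4⟩
    have : ∀ y ≤ n, ∀ i, L[y]? = some i → i ∈ (Nat.rec (f a)
        (fun y IH => IH >>= fun i => g (Nat.pair a (Nat.pair y i))) y : Part ℕ) := by
      intro y
      induction y with
      | zero =>
        intro _ i hi
        rw [h1] at hi
        cases hi
        exact h2
      | succ y ih =>
        intro hy j hj
        obtain ⟨i, j', g1, g2, g3⟩ := h3 y (by omega)
        rw [hj] at g2
        cases g2
        exact Part.mem_bind_iff.2 ⟨i, ih (by omega) i g1, g3⟩
    exact this n le_rfl v h4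

theorem rec_sg {S : Set (Set ℕ)} (hS : SigClass S) {B : Set ℕ}
    (hB : Sg S (fun q : ℕ × ℕ => chi B q.1 = q.2)) {φ : ℕ →. ℕ} (hφ : RecursiveIn (chi B) φ) :
    Sg S (fun q : ℕ × ℕ => q.2 ∈ φ q.1) := by
  induction hφ with
  | zero =>
    refine (Sg.prim hS (P := fun q : ℕ × ℕ => q.2 = 0) (by fun_prop)).of_eq fun q => ?_
    exact Part.mem_some_iff.symm
  | succ =>
    refine (Sg.prim hS (P := fun q : ℕ × ℕ => q.2 = q.1 + 1) (by fun_prop)).of_eq fun q => ?_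
    exact Part.mem_some_iff.symm
  | left =>
    refine (Sg.prim hS (P := fun q : ℕ × ℕ => q.2 = q.1.unpair.1) (by fun_prop)).of_eq fun q => ?_
    exact Part.mem_some_iff.symm
  | right =>
    refine (Sg.prim hS (P := fun q : ℕ × ℕ => q.2 = q.1.unpair.2) (by fun_prop)).of_eq fun q => ?_
    exact Part.mem_some_iff.symm
  | oracle =>
    refine hB.of_eq fun q => ?_
    rw [eq_comm]
    exact Part.mem_some_iff.symm
  | @pair f g _ _ hf hg =>
    have : Sg S (fun q : ℕ × ℕ => ∃ a b : ℕ, a ∈ f q.1 ∧ b ∈ g q.1 ∧ q.2 = Nat.pair a b) := by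
      apply Sg.ex hS
      apply Sg.ex hS
      apply Sg.and hS (hf.comp hS (f := fun r : ((ℕ × ℕ) × ℕ) × ℕ => (r.1.1.1, r.1.2)) (by fun_prop))
      apply Sg.and hS (hg.comp hS (f := fun r : ((ℕ × ℕ) × ℕ) × ℕ => (r.1.1.1, r.2)) (by fun_prop))
      exact Sg.prim hS (by fun_prop)
    refine this.of_eq fun q => ?_
    simp only [Seq.seq, Part.map_eq_map, Part.mem_bind_iff, Part.mem_map_iff]
    constructor
    · rintro ⟨a, b, ha, hb, h⟩
      exact ⟨Nat.pair a, ⟨a, ha, rfl⟩, b, hb, h.symm⟩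
    · rintro ⟨_, ⟨a, ha, rfl⟩, b, hb, h⟩
      exact ⟨a, b, ha, hb, h.symm⟩
  | @comp f g _ _ hf hg =>
    have : Sg S (fun q : ℕ × ℕ => ∃ a : ℕ, a ∈ g q.1 ∧ q.2 ∈ f a) := by
      apply Sg.ex hS
      apply Sg.and hS (hg.comp hS (f := fun r : (ℕ × ℕ) × ℕ => (r.1.1, r.2)) (by fun_prop))
      exact hf.comp hS (f := fun r : (ℕ × ℕ) × ℕ => (r.2, r.1.2)) (by fun_prop)
    exact this.of_eq fun q => Part.mem_bind_iff.symm
  | @prec f g _ _ hf hg =>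
    have : Sg S (fun q : ℕ × ℕ => ∃ L : List ℕ,
        (∃ v0, L[0]? = some v0 ∧ v0 ∈ f q.1.unpair.1) ∧
        (∀ y < q.1.unpair.2, ∃ i j, L[y]? = some i ∧ L[y + 1]? = some j ∧
          j ∈ g (Nat.pair q.1.unpair.1 (Nat.pair y i))) ∧ L[q.1.unpair.2]? = some q.2) := by
      apply Sg.ex hS
      apply Sg.and hS
      · apply Sg.ex hS
        apply Sg.and hS (Sg.prim hS (by fun_prop))
        exact hf.comp hS (f := fun r : ((ℕ × ℕ) × List ℕ) × ℕ => (r.1.1.1.unpair.1, r.2))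
          (by fun_prop)
      apply Sg.and hS
      · apply Sg.ball hS _ (by fun_prop)
        apply Sg.ex hS
        apply Sg.ex hS
        apply Sg.and hS (Sg.prim hS (by fun_prop))
        apply Sg.and hS (Sg.prim hS (by fun_prop))
        exact hg.comp hS (f := fun r : ((((ℕ × ℕ) × List ℕ) × ℕ) × ℕ) × ℕ =>
          (Nat.pair r.1.1.1.1.1.unpair.1 (Nat.pair r.1.1.2 r.1.2), r.2)) (by fun_prop)
      · exact Sg.prim hS (by fun_prop)
    exact this.of_eq fun q => (rec_mem_iff _ _ _).symm
  | @rfind f _ hf =>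
    have : Sg S (fun q : ℕ × ℕ => 0 ∈ f (Nat.pair q.1 q.2) ∧
        ∀ m < q.2, ∃ v, v ∈ f (Nat.pair q.1 m) ∧ ¬ v = 0) := by
      apply Sg.and hS (hf.comp hS (f := fun q : ℕ × ℕ => (Nat.pair q.1 q.2, 0)) (by fun_prop))
      apply Sg.ball hS _ (by fun_prop)
      apply Sg.ex hS
      apply Sg.and hS _ (Sg.prim hS (by fun_prop))
      exact hf.comp hS (f := fun r : ((ℕ × ℕ) × ℕ) × ℕ => (Nat.pair r.1.1.1 r.1.2, r.2))
        (by fun_prop)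
    refine this.of_eq fun q => ?_
    refine Iff.trans ?_ Nat.mem_rfind.symm
    simp

theorem chi_eq_iff {A : Set ℕ} {x v : ℕ} : chi A x = v ↔ (x ∈ A ∧ v = 1) ∨ (x ∉ A ∧ v = 0) := by
  classical
  unfold chi
  by_cases h : x ∈ A
  · simp [h, eq_comm]
  · simp [h, eq_comm]

theorem gr_of_turing {S : Set (Set ℕ)} (hS : SigClass S) {W Z X : Set ℕ} (hZ : Z ∈ S)
    (hZc : Zᶜ ∈ S) (hX : X ∈ S) (hXc : Xᶜ ∈ S) (h : TuringLE W (join Z X)) : Gr W ∈ S := by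
  have hJ : Sg S (fun q : ℕ × ℕ => chi (join Z X) q.1 = q.2) := by
    have : Sg S (fun q : ℕ × ℕ =>
        (((q.1 % 2 = 0 ∧ q.1 / 2 ∈ Z) ∨ (q.1 % 2 = 1 ∧ q.1 / 2 ∈ X)) ∧ q.2 = 1) ∨
        (((q.1 % 2 = 0 ∧ q.1 / 2 ∈ Zᶜ) ∨ (q.1 % 2 = 1 ∧ q.1 / 2 ∈ Xᶜ)) ∧ q.2 = 0)) := by
      have hp : ∀ i, Sg S (fun q : ℕ × ℕ => q.1 % 2 = i) := fun i => Sg.prim hS (by fun_prop)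
      have hm : ∀ Y ∈ S, Sg S (fun q : ℕ × ℕ => q.1 / 2 ∈ Y) := fun Y hY =>
        sg_mem hS hY (by fun_prop)
      exact Sg.or hS
        (Sg.and hS (Sg.or hS (Sg.and hS (hp 0) (hm _ hZ)) (Sg.and hS (hp 1) (hm _ hX)))
          (Sg.prim hS (by fun_prop)))
        (Sg.and hS (Sg.or hS (Sg.and hS (hp 0) (hm _ hZc)) (Sg.and hS (hp 1) (hm _ hXc)))
          (Sg.prim hS (by fun_prop)))
    refine this.of_eq fun q => ?_
    have hj : q.1 ∈ join Z X ↔ ((q.1 % 2 = 0 ∧ q.1 / 2 ∈ Z) ∨ (q.1 % 2 = 1 ∧ q.1 / 2 ∈ X)) := by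
      constructor
      · rintro (⟨m, hm, h⟩ | ⟨m, hm, h⟩)
        · left
          rw [h]
          exact ⟨by omega, by rwa [show 2 * m / 2 = m by omega]⟩
        · right
          rw [h]
          exact ⟨by omega, by rwa [show (2 * m + 1) / 2 = m by omega]⟩
      · rintro (⟨h, hm⟩ | ⟨h, hm⟩)
        · exact Or.inl ⟨_, hm, by omega⟩
        · exact Or.inr ⟨_, hm, by omega⟩
    rw [chi_eq_iff, hj]
    simp only [Set.mem_compl_iff]
    have : q.1 % 2 = 0 ∨ q.1 % 2 = 1 := by omega
    rcases this with h | h <;> simp [h]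
  have h1 := rec_sg hS hJ h
  have h2 : Sg S (fun q : ℕ × ℕ => chi W q.1 = q.2) := h1.of_eq fun q => by
    rw [PFun.coe_val, Part.mem_some_iff, eq_comm]
  exact (sg_gr hS).1 h2

section Final

variable {S : Set (Set ℕ)} {V : Set ℕ} {α : Type*} [Primcodable α]

theorem sg_eqF (hS : SigClass S) {F : ℕ → ℕ} (hF : Sg S (fun q : ℕ × ℕ => F q.1 = q.2))
    {f g : α → ℕ} (hf : Primrec f) (hg : Primrec g) : Sg S (fun a => F (f a) = F (g a)) := by
  have : Sg S (fun a => ∃ v : ℕ, F (f a) = v ∧ F (g a) = v) := by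
    apply Sg.ex hS
    apply Sg.and hS
    · exact hF.comp hS (f := fun q : α × ℕ => (f q.1, q.2)) (by fun_prop)
    · exact hF.comp hS (f := fun q : α × ℕ => (g q.1, q.2)) (by fun_prop)
  refine this.of_eq fun a => ?_
  simp [eq_comm]

theorem sg_neF (hS : SigClass S) {F : ℕ → ℕ} (hF : Sg S (fun q : ℕ × ℕ => F q.1 = q.2))
    {f g : α → ℕ} (hf : Primrec f) (hg : Primrec g) : Sg S (fun a => ¬ F (f a) = F (g a)) := by
  have : Sg S (fun a => ∃ v w : ℕ, F (f a) = v ∧ F (g a) = w ∧ ¬ v = w) := by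
    apply Sg.ex hS
    apply Sg.ex hS
    apply Sg.and hS
    · exact hF.comp hS (f := fun q : (α × ℕ) × ℕ => (f q.1.1, q.1.2)) (by fun_prop)
    apply Sg.and hS
    · exact hF.comp hS (f := fun q : (α × ℕ) × ℕ => (g q.1.1, q.2)) (by fun_prop)
    · exact Sg.prim hS (by fun_prop)
  refine this.of_eq fun a => ?_
  constructor
  · rintro ⟨v, w, rfl, rfl, h⟩
    exact h
  · intro h
    exact ⟨_, _, rfl, rfl, h⟩

theorem b2 {f : ℕ → ℕ → ℕ → ℕ} (hf : Bounded2Triples f) {a b c a' b' c' a'' b'' c'' : ℕ}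
    (h1 : a < b) (h2 : b < c) (h1' : a' < b') (h2' : b' < c') (h1'' : a'' < b'') (h2'' : b'' < c'')
    (e : f a b c = f a' b' c') (e' : f a b c = f a'' b'' c'') :
    (a = a' ∧ b = b' ∧ c = c') ∨ (a = a'' ∧ b = b'' ∧ c = c'') ∨
      (a' = a'' ∧ b' = b'' ∧ c' = c'') := by
  by_contra! hne
  have hsub : ({(a, b, c), (a', b', c'), (a'', b'', c'')} : Set (ℕ × ℕ × ℕ)) ⊆
      {t : ℕ × ℕ × ℕ | t.1 < t.2.1 ∧ t.2.1 < t.2.2 ∧ f t.1 t.2.1 t.2.2 = f a b c} := by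
    rintro t (rfl | rfl | rfl)
    · exact ⟨h1, h2, rfl⟩
    · exact ⟨h1', h2', e.symm⟩
    · exact ⟨h1'', h2'', e'.symm⟩
  have := (Set.encard_le_encard hsub).trans (hf _)
  have h3 : ({(a, b, c), (a', b', c'), (a'', b'', c'')} : Set (ℕ × ℕ × ℕ)).encard = 3 := by
    refine Set.encard_eq_three.2 ⟨_, _, _, ?_, ?_, ?_, rfl⟩
    · intro h
      simp only [Prod.mk.injEq] at h
      exact hne.1 h.1 h.2.1 h.2.2
    · intro h
      simp only [Prod.mk.injEq] at h
      exact hne.2.1 h.1 h.2.1 h.2.2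
    · intro h
      simp only [Prod.mk.injEq] at h
      exact hne.2.2 h.1 h.2.1 h.2.2
  rw [h3] at this
  exact absurd this (by decide)

/-- The colouring on increasing triples is injective on the members of the list. -/
def RB (F : ℕ → ℕ) (q : List ℕ) : Prop :=
  ∀ a ∈ q, ∀ b ∈ q, ∀ c ∈ q, ∀ a' ∈ q, ∀ b' ∈ q, ∀ c' ∈ q,
    (a < b ∧ b < c ∧ a' < b' ∧ b' < c' ∧ ¬ (a = a' ∧ b = b' ∧ c = c')) →
    ¬ F (Nat.pair a (Nat.pair b c)) = F (Nat.pair a' (Nat.pair b' c'))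

theorem sg_rb (hS : SigClass S) {F : ℕ → ℕ} (hF : Sg S (fun q : ℕ × ℕ => F q.1 = q.2)) :
    Sg S (RB F) := by
  unfold RB
  apply Sg.ballList hS _ (by fun_prop)
  apply Sg.ballList hS _ (by fun_prop)
  apply Sg.ballList hS _ (by fun_prop)
  apply Sg.ballList hS _ (by fun_prop)
  apply Sg.ballList hS _ (by fun_prop)
  apply Sg.ballList hS _ (by fun_prop)
  apply Sg.imp hS (by fun_prop)
  exact sg_neF hS hF (by fun_prop) (by fun_prop)

open Filter in
theorem rb_extend {f : ℕ → ℕ → ℕ → ℕ} (hf : Bounded2Triples f) {F : ℕ → ℕ}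
    (hFf : ∀ x y z : ℕ, x < y → y < z → F (Nat.pair x (Nat.pair y z)) = f x y z)
    {Y : Set ℕ} (hY : Y.Infinite)
    (hcoh : ∀ a ∈ Y, ∀ b ∈ Y, ∀ a' ∈ Y, ∀ b' ∈ Y, a < b → a' < b' → ¬ (a = a' ∧ b = b') →
      ∃ B, ∀ z ∈ Y, B < z →
        ¬ F (Nat.pair a (Nat.pair b z)) = F (Nat.pair a' (Nat.pair b' z)))
    (q : List ℕ) (hq : IncIn Y q ∧ RB F q) :
    ∃ E, (IncIn Y (q ++ E) ∧ RB F (q ++ E)) ∧ E ≠ [] := by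
  have hfin : {x | x ∈ q}.Finite := q.finite_toSet
  have e1 : ∀ᶠ z in atTop, ∀ a ∈ {x | x ∈ q}, a < z := by
    rw [eventually_all_finite hfin]
    intro a _
    exact eventually_gt_atTop a
  have e2 : ∀ᶠ z in atTop, ∀ a ∈ {x | x ∈ q}, ∀ b ∈ {x | x ∈ q}, ∀ a' ∈ {x | x ∈ q},
      ∀ b' ∈ {x | x ∈ q}, a < b → a' < b' → ¬ (a = a' ∧ b = b') → z ∈ Y →
        ¬ F (Nat.pair a (Nat.pair b z)) = F (Nat.pair a' (Nat.pair b' z)) := by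
    rw [eventually_all_finite hfin]
    intro a ha
    rw [eventually_all_finite hfin]
    intro b hb
    rw [eventually_all_finite hfin]
    intro a' ha'
    rw [eventually_all_finite hfin]
    intro b' hb'
    by_cases h : a < b ∧ a' < b' ∧ ¬ (a = a' ∧ b = b')
    · obtain ⟨B, hB⟩ := hcoh a (hq.1.2 a ha) b (hq.1.2 b hb) a' (hq.1.2 a' ha') b'
        (hq.1.2 b' hb') h.1 h.2.1 h.2.2
      filter_upwards [eventually_gt_atTop B] with z hz _ _ _ hzY
      exact hB z hzY hz
    · exact Eventually.of_forall fun z h1 h2 h3 => absurd ⟨h1, h2, h3⟩ h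
  have e3 : ∀ᶠ z in atTop, ∀ a ∈ {x | x ∈ q}, ∀ b ∈ {x | x ∈ q}, ∀ a' ∈ {x | x ∈ q},
      ∀ b' ∈ {x | x ∈ q}, ∀ c' ∈ {x | x ∈ q}, a < b → a' < b' → b' < c' →
        ¬ F (Nat.pair a (Nat.pair b z)) = F (Nat.pair a' (Nat.pair b' c')) := by
    rw [eventually_all_finite hfin]
    intro a ha
    rw [eventually_all_finite hfin]
    intro b hb
    rw [eventually_all_finite hfin]
    intro a' ha'
    rw [eventually_all_finite hfin]
    intro b' hb'
    rw [eventually_all_finite hfin]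
    intro c' hc'
    by_cases h : a < b ∧ a' < b' ∧ b' < c'
    · obtain ⟨h1, h2, h3⟩ := h
      by_contra hc
      have hc := frequently_atTop'.1 (not_eventually.1 hc)
      obtain ⟨z1, hz1, g1⟩ := hc (b + c')
      obtain ⟨z2, hz2, g2⟩ := hc z1
      push Not at g1 g2
      have k1 := g1.2.2.2
      have k2 := g2.2.2.2
      rw [hFf a b z1 h1 (by omega), hFf a' b' c' h2 h3] at k1
      rw [hFf a b z2 h1 (by omega), hFf a' b' c' h2 h3] at k2
      have := b2 hf h1 (show b < z1 by omega) h1 (show b < z2 by omega) h2 h3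
        (k1.trans k2.symm) k1
      omega
    · exact Eventually.of_forall fun z h1 h2 h3 => absurd ⟨h1, h2, h3⟩ h
  obtain ⟨z, hzY, h1, h2, h3⟩ :=
    ((Nat.frequently_atTop_iff_infinite.2 hY).and_eventually (e1.and (e2.and e3))).exists
  simp only [Set.mem_ofPred_eq] at h1 h2 h3
  refine ⟨[z], ⟨⟨?_, ?_⟩, ?_⟩, by simp⟩
  · refine List.pairwise_append.2 ⟨hq.1.1, by simp, ?_⟩
    intro a ha b hb
    rw [List.mem_singleton.1 hb]
    exact h1 a ha
  · intro e he
    rcases List.mem_append.1 he with he | he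
    · exact hq.1.2 e he
    · rwa [List.mem_singleton.1 he]
  · have hmem : ∀ e ∈ q ++ [z], e ∈ q ∧ e < z ∨ e = z := by
      intro e he
      rcases List.mem_append.1 he with he | he
      · exact Or.inl ⟨he, h1 e he⟩
      · exact Or.inr (List.mem_singleton.1 he)
    have hlt : ∀ e ∈ q ++ [z], e < z → e ∈ q := by
      intro e he hez
      rcases hmem e he with h | h
      · exact h.1
      · omega
    rintro a ha b hb c hc a' ha' b' hb' c' hc' ⟨l1, l2, l3, l4, hne⟩
    rcases hmem c hc with ⟨hcq, hcz⟩ | rfl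
    · rcases hmem c' hc' with ⟨hcq', hcz'⟩ | rfl
      · exact hq.2 a (hlt a ha (by omega)) b (hlt b hb (by omega)) c hcq
          a' (hlt a' ha' (by omega)) b' (hlt b' hb' (by omega)) c' hcq' ⟨l1, l2, l3, l4, hne⟩
      · intro h
        exact h3 a' (hlt a' ha' (by omega)) b' (hlt b' hb' (by omega))
          a (hlt a ha (by omega)) b (hlt b hb (by omega)) c hcq l3 l1 l2 h.symm
    · rcases hmem c' hc' with ⟨hcq', hcz'⟩ | rfl
      · exact h3 a (hlt a ha (by omega)) b (hlt b hb (by omega))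
          a' (hlt a' ha' (by omega)) b' (hlt b' hb' (by omega)) c' hcq' l1 l3 l4
      · exact h2 a (hlt a ha (by omega)) b (hlt b hb (by omega))
          a' (hlt a' ha' (by omega)) b' (hlt b' hb' (by omega)) l1 l3
          (fun h => hne ⟨h.1, h.2, rfl⟩) hzY

/-- Two pairs eventually receive the same colour along `C`. -/
def MR (F : ℕ → ℕ) (C : Set ℕ) (u v : ℕ) : Prop :=
  u ≠ v ∧ u.unpair.1 < u.unpair.2 ∧ v.unpair.1 < v.unpair.2 ∧
    ∃ B, ∀ z ∈ C, B < z → F (Nat.pair u.unpair.1 (Nat.pair u.unpair.2 z)) =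
      F (Nat.pair v.unpair.1 (Nat.pair v.unpair.2 z))

theorem MR.symm {F : ℕ → ℕ} {C : Set ℕ} {u v : ℕ} (h : MR F C u v) : MR F C v u := by
  obtain ⟨h1, h2, h3, B, h4⟩ := h
  exact ⟨h1.symm, h3, h2, B, fun z hz hB => (h4 z hz hB).symm⟩

theorem deg_mr {f : ℕ → ℕ → ℕ → ℕ} (hf : Bounded2Triples f) {F : ℕ → ℕ}
    (hFf : ∀ x y z : ℕ, x < y → y < z → F (Nat.pair x (Nat.pair y z)) = f x y z)
    {C : Set ℕ} (hC : C.Infinite) : Deg (MR F C) 1 := by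
  intro u L hL h
  match L, hL, h with
  | [], _, _ => simp
  | [_], _, _ => simp
  | v :: w :: L, hL, h =>
    exfalso
    have hvw : v < w := by
      have := (List.pairwise_cons.1 hL).1 w (by simp)
      exact this
    have hv : MR F C u v := (h v (by simp)).elim id MR.symm
    have hw : MR F C u w := (h w (by simp)).elim id MR.symm
    obtain ⟨n1, l1, l2, B, hB⟩ := hv
    obtain ⟨n2, -, l3, B', hB'⟩ := hw
    obtain ⟨z, hz, hlt⟩ := hC.exists_gt (B + B' + u.unpair.2 + v.unpair.2 + w.unpair.2)
    have k1 := hB z hz (by omega)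
    have k2 := hB' z hz (by omega)
    rw [hFf _ _ z l1 (by omega), hFf _ _ z l2 (by omega)] at k1
    rw [hFf _ _ z l1 (by omega), hFf _ _ z l3 (by omega)] at k2
    have hinj : ∀ s t : ℕ, s.unpair.1 = t.unpair.1 ∧ s.unpair.2 = t.unpair.2 ∧ z = z → s = t := by
      intro s t hst
      rw [← Nat.pair_unpair s, ← Nat.pair_unpair t, hst.1, hst.2.1]
    rcases b2 hf l1 (show _ < z by omega) l2 (show _ < z by omega) l3 (show _ < z by omega) k1 k2
      with h | h | h
    · exact n1 (hinj _ _ h)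
    · exact n2 (hinj _ _ h)
    · have := hinj _ _ h
      omega

end Final

/-- cone avoidance for RRT³₂: if `W ≰_T Z` and `f` is a 2-bounded coloring
of `[ℕ]³` computable relative to an oracle for `Z`, then there is an infinite
`f`-rainbow `X` with `W ≰_T Z ⊕ X`. -/
theorem statement10 (W Z : Set ℕ) (hWZ : ¬ TuringLE W Z) (f : ℕ → ℕ → ℕ → ℕ)
    (hbounded : Bounded2Triples f)
    (hcomp : ∃ F : ℕ → ℕ, FunRecIn Z F ∧
      ∀ x y z : ℕ, x < y → y < z → F (Nat.pair x (Nat.pair y z)) = f x y z) :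
    ∃ X : Set ℕ, X.Infinite ∧ Rainbow3On f X ∧ ¬ TuringLE W (join Z X) := by
  obtain ⟨F, hF, hFf⟩ := hcomp
  have hS0 := re_sig (chi Z)
  have hV0 : Gr W ∉ RE (chi Z) := fun h => hWZ (turing_of_gr h)
  have hF0 : Sg (RE (chi Z)) (fun q : ℕ × ℕ => F q.1 = q.2) := graph_re hF
  have hZ0 : Sg (RE (chi Z)) (fun q : ℕ × ℕ => chi Z q.1 = q.2) := graph_re RecursiveIn.oracle
  have hZ : Z ∈ RE (chi Z) := by
    have := hZ0.comp hS0 (f := fun n : ℕ => (n, 1)) (by fun_prop)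
    have := sg_nat.1 this
    convert this using 1
    ext n
    simp [chi_eq_iff]
  have hZc : Zᶜ ∈ RE (chi Z) := by
    have := hZ0.comp hS0 (f := fun n : ℕ => (n, 0)) (by fun_prop)
    have := sg_nat.1 this
    convert this using 1
    ext n
    simp [chi_eq_iff]
  -- a cohesive set
  obtain ⟨S1, hS1, hS01, hV1, C, hC, hCinf, hcoh⟩ := coh hS0 hV0 (ι := (ℕ × ℕ) × (ℕ × ℕ))
    (fun i => {z | F (Nat.pair i.1.1 (Nat.pair i.1.2 z)) = F (Nat.pair i.2.1 (Nat.pair i.2.2 z))})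
    (fun i => sg_nat.1 (sg_eqF hS0 hF0 (by fun_prop) (by fun_prop)))
    (fun i => sg_nat.1 (sg_neF hS0 hF0 (by fun_prop) (by fun_prop)))
  -- thin out for the limit colouring of pairs
  obtain ⟨S2, hS2, hS12, hV2, Y, hY, hYinf, hYC, hYM⟩ :=
    strong_pairs hS1 hV1 hC hCinf (deg_mr hbounded hFf hCinf)
  have hF2 : Sg S2 (fun q : ℕ × ℕ => F q.1 = q.2) := (hF0.mono hS01).mono hS12
  -- the final path
  obtain ⟨H, hV3, ℓ, hQ, hpre, hl⟩ := path hS2 hV2 (Q := fun q => IncIn Y q ∧ RB F q)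
    (Sg.and hS2 (sg_incIn hS2 hY) (sg_rb hS2 hF2)) []
    ⟨incIn_nil, fun a ha => by simp at ha⟩
    (rb_extend hbounded hFf hYinf (by
      intro a ha b hb a' ha' b' hb' h1 h2 h3
      obtain ⟨B, hB | hB⟩ := hcoh ((a, b), (a', b'))
      · refine absurd ?_ (hYM a ha b hb a' ha' b' hb' h1 h2 h3)
        refine ⟨fun h => h3 (Nat.pair_eq_pair.1 h), by simpa using h1, by simpa using h2, B, ?_⟩
        intro z hz hBz
        have := hB z hz hBz
        simpa using this
      · exact ⟨B, fun z hz hBz => hB z (hYC hz) hBz⟩))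
  obtain ⟨hHm, hHl⟩ := range_facts (fun i => (hQ i).1.1) hpre hl
  have hsub : ∀ A ∈ RE (chi Z), A ∈ Ext S2 H := fun A hA => sub_ext hS2 (hS12 (hS01 hA))
  refine ⟨Set.range H, Set.infinite_range_of_injective hHm.injective, ?_, ?_⟩
  · have hall : ∀ k, ∃ i, ∀ j ≤ k, H j ∈ ℓ i := by
      intro k
      obtain ⟨i, hi⟩ := hl (k + 1)
      refine ⟨i, fun j hj => ?_⟩
      rw [hpre i]
      simp only [pre, List.mem_map, List.mem_range]
      exact ⟨j, by omega, rfl⟩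
    rintro _ _ _ _ _ _ ⟨a, rfl⟩ ⟨b, rfl⟩ ⟨c, rfl⟩ ⟨a', rfl⟩ ⟨b', rfl⟩ ⟨c', rfl⟩ h1 h2 h3 h4 he
    obtain ⟨i, hi⟩ := hall (a + b + c + a' + b' + c')
    by_contra hne
    refine (hQ i).2 _ (hi a (by omega)) _ (hi b (by omega)) _ (hi c (by omega)) _
      (hi a' (by omega)) _ (hi b' (by omega)) _ (hi c' (by omega)) ⟨h1, h2, h3, h4, hne⟩ ?_
    rw [hFf _ _ _ h1 h2, hFf _ _ _ h3 h4, he]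
  · intro h
    exact hV3 (gr_of_turing (ext_sig hS2) (hsub _ hZ) (hsub _ hZc) (range_mem_ext hS2)
      (compl_range_mem_ext hS2 hHm) h)

end RRT
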